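/- If G is a graph in obs(P1) that is not isomorphic to any of the 33 graphs in O, then either K4 is not a minor of G, or G is biconnected. -/

import Mathlib

open SimpleGraph

/-- `H` is a minor of `G` (branch-set definition): there is a family of connected, nonempty,
pairwise disjoint branch sets in `G`, indexed by the vertices of `H`, such that vertices
adjacent in `H` have an edge of `G` between their branch sets. -/
def IsMinorOf {W V : Type} (H : SimpleGraph W) (G : SimpleGraph V) : Prop :=
  ∃ f : W → Set V,
    (∀ w, (G.induce (f w)).Connected) ∧
    (∀ ⦃w w' : W⦄, w ≠ w' → Disjoint (f w) (f w')) ∧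
    (∀ ⦃w w' : W⦄, H.Adj w w' → ∃ a ∈ f w, ∃ b ∈ f w', G.Adj a b)

/-- A pseudoforest: every connected component contains at most one cycle, i.e. any two
cycles lying in the same connected component have the same edge set. -/
def Pseudoforest {V : Type} (G : SimpleGraph V) : Prop :=
  ∀ ⦃u v : V⦄ (c : G.Walk u u) (c' : G.Walk v v),
    c.IsCycle → c'.IsCycle → G.Reachable u v → ∀ e, e ∈ c.edges ↔ e ∈ c'.edges

/-- An apex-pseudoforest: removing at most one vertex yields a pseudoforest. -/
def ApexPseudoforest {V : Type} (G : SimpleGraph V) : Prop :=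
  ∃ s : Set V, s.Subsingleton ∧ Pseudoforest (G.induce sᶜ)

/-- `G` is a minor-obstruction for the class of apex-pseudoforests: `G` is not an
apex-pseudoforest but every proper minor of `G` is. -/
def ObsApexPseudoforest {V : Type} (G : SimpleGraph V) : Prop :=
  ¬ ApexPseudoforest G ∧
    ∀ (W : Type) [Finite W] (H : SimpleGraph W),
      IsMinorOf H G → IsEmpty (H ≃g G) → ApexPseudoforest H

/-- `G` is `k`-connected: between any two distinct vertices `u ≠ v` there exist `k`
pairwise distinct `(u,v)`-paths, any two of which share no vertices other than `u,v`. -/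
def KConnected {V : Type} (k : ℕ) (G : SimpleGraph V) : Prop :=
  ∀ ⦃u v : V⦄, u ≠ v → ∃ P : Fin k → G.Walk u v,
    Function.Injective P ∧ (∀ i, (P i).IsPath) ∧
      ∀ i j, i ≠ j → ∀ x, x ∈ (P i).support → x ∈ (P j).support → x = u ∨ x = v

/-- The simple graph on `Fin n` with the given list of (0-indexed) edges. -/
def mkGraph (n : ℕ) (E : List (ℕ × ℕ)) : SimpleGraph (Fin n) :=
  SimpleGraph.fromRel fun a b => ((a : ℕ), (b : ℕ)) ∈ E

/-- Obstruction 1: two disjoint diamonds. -/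
def O1 : SimpleGraph (Fin 8) :=
  mkGraph 8 [(0,1),(0,2),(0,3),(1,2),(1,3),(4,5),(4,6),(4,7),(5,6),(5,7)]
/-- Obstruction 2: two disjoint butterflies. -/
def O2 : SimpleGraph (Fin 10) :=
  mkGraph 10 [(0,1),(0,2),(1,2),(0,3),(0,4),(3,4),(5,6),(5,7),(6,7),(5,8),(5,9),(8,9)]
/-- Obstruction 3: a diamond plus a butterfly. -/
def O3 : SimpleGraph (Fin 9) :=
  mkGraph 9 [(0,1),(0,2),(0,3),(1,2),(1,3),(4,5),(4,6),(5,6),(4,7),(4,8),(7,8)]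
def O4 : SimpleGraph (Fin 8) :=
  mkGraph 8 [(0,1),(0,2),(1,2),(2,3),(2,4),(3,4),(3,5),(4,5),(5,6),(5,7),(6,7)]
def O5 : SimpleGraph (Fin 8) :=
  mkGraph 8 [(0,1),(0,2),(1,2),(2,3),(2,4),(3,4),(3,5),(4,6),(5,6),(5,7),(6,7)]
def O6 : SimpleGraph (Fin 8) :=
  mkGraph 8 [(0,1),(0,2),(1,2),(2,3),(2,4),(3,4),(3,5),(4,5),(3,6),(5,6),(4,7),(5,7)]
def O7 : SimpleGraph (Fin 7) :=
  mkGraph 7 [(0,1),(0,6),(1,6),(2,3),(2,4),(2,5),(3,4),(3,5),(4,6),(5,6)]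
def O8 : SimpleGraph (Fin 7) :=
  mkGraph 7 [(0,1),(0,2),(1,2),(2,3),(2,4),(2,5),(3,4),(3,5),(4,5),(4,6),(5,6)]
def O9 : SimpleGraph (Fin 9) :=
  mkGraph 9 [(0,1),(0,2),(1,2),(2,3),(2,4),(3,4),(3,5),(4,5),(2,6),(4,6),(2,7),(3,7),(3,8),(4,8)]
def O10 : SimpleGraph (Fin 9) :=
  mkGraph 9 [(0,1),(1,2),(2,3),(3,0),(0,4),(1,4),(1,5),(2,5),(2,6),(3,6),(0,7),(0,8),(7,8)]
def O11 : SimpleGraph (Fin 9) :=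
  mkGraph 9 [(0,1),(0,2),(1,2),(3,4),(3,5),(4,5),(6,7),(6,8),(7,8),(2,3),(1,8),(4,8)]
def O12 : SimpleGraph (Fin 9) :=
  mkGraph 9 [(0,1),(0,2),(1,2),(3,4),(3,5),(4,5),(6,7),(6,8),(7,8),(2,3),(2,7),(3,6)]
def O13 : SimpleGraph (Fin 9) :=
  mkGraph 9 [(0,1),(0,2),(1,2),(3,4),(3,5),(4,5),(6,7),(6,8),(7,8),(2,3),(2,8),(3,8)]
def O14 : SimpleGraph (Fin 8) :=
  mkGraph 8 [(0,1),(0,2),(1,2),(1,4),(2,3),(2,4),(3,4),(3,5),(4,5),(1,6),(1,7),(6,7)]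
def O15 : SimpleGraph (Fin 9) :=
  mkGraph 9 [(0,1),(0,2),(1,2),(2,3),(2,4),(3,4),(4,5),(4,6),(5,6),(6,7),(6,8),(7,8),(2,6)]
def O16 : SimpleGraph (Fin 6) :=
  mkGraph 6 [(0,2),(0,3),(0,4),(0,5),(1,2),(1,3),(1,4),(1,5),(2,3),(4,5)]
def O17 : SimpleGraph (Fin 6) :=
  mkGraph 6 [(0,1),(1,3),(3,2),(2,0),(4,0),(4,1),(4,2),(4,3),(5,0),(5,1)]
def O18 : SimpleGraph (Fin 8) :=
  mkGraph 8 [(0,1),(1,2),(2,3),(3,0),(4,0),(4,1),(5,1),(5,2),(6,2),(6,3),(7,3),(7,0)]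
def O19 : SimpleGraph (Fin 7) :=
  mkGraph 7 [(0,2),(0,3),(1,2),(1,3),(2,3),(0,4),(4,1),(5,0),(5,4),(6,4),(6,1)]
def O20 : SimpleGraph (Fin 6) :=
  mkGraph 6 [(1,2),(1,4),(1,5),(2,4),(2,5),(4,5),(0,1),(0,4),(2,3),(3,5)]
def O21 : SimpleGraph (Fin 7) :=
  mkGraph 7 [(0,1),(0,3),(0,4),(1,3),(1,4),(3,5),(4,5),(1,2),(2,4),(3,6),(5,6)]
def O22 : SimpleGraph (Fin 8) :=
  mkGraph 8 [(0,1),(0,3),(1,4),(3,4),(1,2),(2,4),(7,0),(7,3),(5,7),(5,0),(6,7),(6,3)]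
def O23 : SimpleGraph (Fin 7) :=
  mkGraph 7 [(2,3),(2,4),(2,6),(3,4),(3,6),(4,6),(5,3),(5,4),(0,2),(0,3),(1,2),(1,4)]
def O24 : SimpleGraph (Fin 7) :=
  mkGraph 7 [(0,1),(0,2),(1,2),(1,3),(2,4),(3,5),(3,6),(4,5),(4,6),(5,6)]
def O25 : SimpleGraph (Fin 8) :=
  mkGraph 8 [(0,1),(0,3),(1,3),(1,2),(1,5),(2,5),(1,7),(2,7),(3,4),(4,5),(3,5),(3,6),(5,6)]
def O26 : SimpleGraph (Fin 9) :=
  mkGraph 9 [(2,3),(2,4),(3,4),(5,3),(5,4),(8,3),(8,4),(0,2),(0,3),(7,2),(7,3),(1,2),(1,4),(6,2),(6,4)]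
def O27 : SimpleGraph (Fin 8) :=
  mkGraph 8 [(0,2),(1,2),(0,3),(2,3),(1,6),(2,6),(3,4),(6,7),(4,5),(5,7),(3,7),(4,7)]
def O28 : SimpleGraph (Fin 7) :=
  mkGraph 7 [(0,1),(0,2),(1,2),(1,3),(1,5),(3,5),(3,4),(3,6),(4,6),(2,5),(5,6)]
def O29 : SimpleGraph (Fin 9) :=
  mkGraph 9 [(0,1),(0,2),(1,2),(3,4),(3,5),(4,5),(6,7),(6,8),(7,8),(2,3),(1,7),(4,6)]
def O30 : SimpleGraph (Fin 8) :=
  mkGraph 8 [(0,1),(0,2),(1,2),(3,4),(3,5),(4,5),(6,7),(1,6),(4,6),(0,7),(5,7)]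
/-- Obstruction 31: the prism. -/
def O31 : SimpleGraph (Fin 6) :=
  mkGraph 6 [(0,1),(0,2),(1,2),(3,4),(3,5),(4,5),(0,3),(1,4),(2,5)]
/-- Obstruction 32: `K₃,₃`. -/
def O32 : SimpleGraph (Fin 6) :=
  mkGraph 6 [(0,3),(0,4),(0,5),(1,3),(1,4),(1,5),(2,3),(2,4),(2,5)]
/-- Obstruction 33: `K₅` minus one edge. -/
def O33 : SimpleGraph (Fin 5) :=
  mkGraph 5 [(0,1),(0,2),(0,3),(0,4),(1,2),(1,3),(1,4),(2,3),(2,4)]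

/-- The list `O` of the 33 obstructions. -/
def OList : List ((n : ℕ) × SimpleGraph (Fin n)) :=
  [⟨8, O1⟩, ⟨10, O2⟩, ⟨9, O3⟩, ⟨8, O4⟩, ⟨8, O5⟩, ⟨8, O6⟩, ⟨7, O7⟩, ⟨7, O8⟩, ⟨9, O9⟩,
   ⟨9, O10⟩, ⟨9, O11⟩, ⟨9, O12⟩, ⟨9, O13⟩, ⟨8, O14⟩, ⟨9, O15⟩, ⟨6, O16⟩, ⟨6, O17⟩,
   ⟨8, O18⟩, ⟨7, O19⟩, ⟨6, O20⟩, ⟨7, O21⟩, ⟨8, O22⟩, ⟨7, O23⟩, ⟨7, O24⟩, ⟨8, O25⟩,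
   ⟨9, O26⟩, ⟨8, O27⟩, ⟨7, O28⟩, ⟨9, O29⟩, ⟨8, O30⟩, ⟨6, O31⟩, ⟨6, O32⟩, ⟨5, O33⟩]

/-- `G` is isomorphic to one of the 33 graphs in `O`. -/
def InO {V : Type} (G : SimpleGraph V) : Prop :=
  ∃ H ∈ OList, Nonempty (G ≃g H.2)

/-- `S` is nonempty and connected in `G`: a subset of `S` closed under adjacency within `S`
is empty or all of `S`. -/
def ConnSet {V : Type} (G : SimpleGraph V) (S : Set V) : Prop :=
  S.Nonempty ∧ ∀ U : Set V, (∃ x ∈ S, x ∈ U) →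
    (∀ a ∈ S, a ∈ U → ∀ b ∈ S, G.Adj a b → b ∈ U) → S ⊆ U

/-- There is an edge of `G` between `A` and `B`. -/
def Touch {V : Type} (G : SimpleGraph V) (A B : Set V) : Prop :=
  ∃ a ∈ A, ∃ b ∈ B, G.Adj a b

section Connectivity

variable {V : Type} {G : SimpleGraph V} {A B C S T : Set V} {u v w : V}

theorem Touch.symm (h : Touch G A B) : Touch G B A := by
  obtain ⟨a, ha, b, hb, hab⟩ := h
  exact ⟨b, hb, a, ha, hab.symm⟩

theorem Touch.mono {A' B' : Set V} (h : Touch G A B) (hA : A ⊆ A') (hB : B ⊆ B') :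
    Touch G A' B' := by
  obtain ⟨a, ha, b, hb, hab⟩ := h
  exact ⟨a, hA ha, b, hB hb, hab⟩

theorem Touch.union_left (h : Touch G (A ∪ B) C) : Touch G A C ∨ Touch G B C := by
  obtain ⟨a, ha | ha, b, hb, hab⟩ := h
  · exact Or.inl ⟨a, ha, b, hb, hab⟩
  · exact Or.inr ⟨a, ha, b, hb, hab⟩

theorem connected_induce_iff_connSet : (G.induce S).Connected ↔ ConnSet G S := by
  constructor
  · intro h
    refine ⟨Set.nonempty_coe_sort.1 h.nonempty, ?_⟩
    rintro U ⟨x, hxS, hxU⟩ hU y hy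
    obtain ⟨p⟩ := h.preconnected ⟨x, hxS⟩ ⟨y, hy⟩
    have key : ∀ {a b : S} (p : (G.induce S).Walk a b), (a : V) ∈ U → (b : V) ∈ U := by
      intro a b p
      induction p with
      | nil => exact id
      | cons hadj _ ih => exact fun ha => ih (hU _ (Subtype.coe_prop _) ha _ (Subtype.coe_prop _) hadj)
    exact key p hxU
  · rintro ⟨⟨x, hx⟩, h⟩
    rw [connected_iff_exists_forall_reachable]
    refine ⟨⟨x, hx⟩, ?_⟩
    have := h {y | ∃ hy : y ∈ S, (G.induce S).Reachable ⟨x, hx⟩ ⟨y, hy⟩}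
      ⟨x, hx, hx, Reachable.refl _⟩ (by
        rintro a ha ⟨_, hr⟩ b hb hab
        exact ⟨hb, hr.trans (Adj.reachable (by simpa using hab))⟩)
    rintro ⟨y, hy⟩
    exact (this hy).2

theorem ConnSet.cross (h : ConnSet G S) {U : Set V} (h1 : ∃ x ∈ S, x ∈ U) (h2 : ∃ x ∈ S, x ∉ U) :
    ∃ a ∈ S, a ∈ U ∧ ∃ b ∈ S, b ∉ U ∧ G.Adj a b := by
  by_contra! hc
  obtain ⟨x, hx, hxU⟩ := h2
  refine hxU (h.2 U h1 ?_ hx)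
  intro a ha haU b hb hab
  by_contra hbU
  exact hc a ha haU b hb hbU hab

theorem connSet_singleton (v : V) : ConnSet G {v} := by
  refine ⟨⟨v, rfl⟩, ?_⟩
  rintro U ⟨x, rfl, hx⟩ - y rfl
  exact hx

theorem ConnSet.union (hA : ConnSet G A) (hB : ConnSet G B) (h : Touch G A B) :
    ConnSet G (A ∪ B) := by
  obtain ⟨a, ha, b, hb, hab⟩ := h
  refine ⟨⟨a, Or.inl ha⟩, ?_⟩
  rintro U ⟨x, hx, hxU⟩ hU
  have hA' : (∃ x ∈ A, x ∈ U) → A ⊆ U := fun h => hA.2 U h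
    fun a ha haU b hb => hU a (Or.inl ha) haU b (Or.inl hb)
  have hB' : (∃ x ∈ B, x ∈ U) → B ⊆ U := fun h => hB.2 U h
    fun a ha haU b hb => hU a (Or.inr ha) haU b (Or.inr hb)
  rcases hx with hx | hx
  · have h1 := hA' ⟨x, hx, hxU⟩
    exact Set.union_subset h1
      (hB' ⟨b, hb, hU a (Or.inl ha) (h1 ha) b (Or.inr hb) hab⟩)
  · have h1 := hB' ⟨x, hx, hxU⟩
    exact Set.union_subset
      (hA' ⟨a, ha, hU b (Or.inr hb) (h1 hb) a (Or.inl ha) hab.symm⟩) h1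

theorem ConnSet.union_of_mem (hA : ConnSet G A) (hB : ConnSet G B) (ha : v ∈ A) (hb : v ∈ B) :
    ConnSet G (A ∪ B) := by
  refine ⟨⟨v, Or.inl ha⟩, ?_⟩
  rintro U ⟨x, hx, hxU⟩ hU
  have hA' : (∃ x ∈ A, x ∈ U) → A ⊆ U := fun h => hA.2 U h
    fun a ha haU b hb => hU a (Or.inl ha) haU b (Or.inl hb)
  have hB' : (∃ x ∈ B, x ∈ U) → B ⊆ U := fun h => hB.2 U h
    fun a ha haU b hb => hU a (Or.inr ha) haU b (Or.inr hb)
  rcases hx with hx | hx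
  · have h1 := hA' ⟨x, hx, hxU⟩
    exact Set.union_subset h1 (hB' ⟨v, hb, h1 ha⟩)
  · have h1 := hB' ⟨x, hx, hxU⟩
    exact Set.union_subset (hA' ⟨v, ha, h1 hb⟩) h1

/-- Every vertex of `S` lies in a connected component of `S`. -/
theorem exists_component (hx : v ∈ S) :
    ∃ K ⊆ S, v ∈ K ∧ ConnSet G K ∧ ∀ a ∈ K, ∀ b ∈ S, G.Adj a b → b ∈ K := by
  refine ⟨⋃₀ {T | T ⊆ S ∧ v ∈ T ∧ ConnSet G T}, Set.sUnion_subset fun T hT => hT.1,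
    ⟨{v}, ⟨by simpa using hx, rfl, connSet_singleton v⟩, rfl⟩, ⟨⟨v, {v},
    ⟨by simpa using hx, rfl, connSet_singleton v⟩, rfl⟩, ?_⟩, ?_⟩
  · rintro U ⟨x, ⟨T, hT, hxT⟩, hxU⟩ hU
    have key : ∀ T, T ⊆ S ∧ v ∈ T ∧ ConnSet G T → (∃ x ∈ T, x ∈ U) → T ⊆ U := by
      intro T hT hne
      exact hT.2.2.2 U hne fun a ha haU b hb => hU a ⟨T, hT, ha⟩ haU b ⟨T, hT, hb⟩
    have hv : v ∈ U := key T hT ⟨x, hxT, hxU⟩ hT.2.1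
    exact Set.sUnion_subset fun T' hT' => key T' hT' ⟨v, hT'.2.1, hv⟩
  · rintro a ⟨T, hT, haT⟩ b hb hab
    exact ⟨T ∪ {b}, ⟨Set.union_subset hT.1 (by simpa using hb), Or.inl hT.2.1,
      hT.2.2.union (connSet_singleton b) ⟨a, haT, b, rfl, hab⟩⟩, Or.inr rfl⟩

/-- If `U` has no edges to its complement except through `v`, a connected set containing `v`
meets `insert v U` in a connected set. -/
theorem ConnSet.inter_insert (hS : ConnSet G S) (hv : v ∈ S) {U : Set V}
    (hU : ∀ a ∈ U, ∀ b ∈ S, b ∉ U → b ≠ v → ¬ G.Adj a b) : ConnSet G (S ∩ insert v U) := by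
  refine ⟨⟨v, hv, Or.inl rfl⟩, ?_⟩
  rintro W ⟨x, ⟨hxS, hxU⟩, hxW⟩ hW
  have hvW : v ∈ W := by
    by_contra hvW
    obtain ⟨a, haS, ⟨haU, haW⟩, b, hbS, hb, hab⟩ := hS.cross (U := (insert v U) ∩ W)
      ⟨x, hxS, hxU, hxW⟩ ⟨v, hv, fun h => hvW h.2⟩
    have hav : a ≠ v := fun h => hvW (h ▸ haW)
    have haU' : a ∈ U := haU.resolve_left hav
    by_cases hbU : b ∈ insert v U
    · exact hb ⟨hbU, hW a ⟨haS, haU⟩ haW b ⟨hbS, hbU⟩ hab⟩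
    · exact hU a haU' b hbS (fun h => hbU (Or.inr h)) (fun h => hbU (Or.inl h)) hab
  have := hS.2 (W ∪ (insert v U)ᶜ) ⟨v, hv, Or.inl hvW⟩ (by
    rintro a haS haW b hbS hab
    by_cases hbU : b ∈ insert v U
    · left
      by_cases haU : a ∈ insert v U
      · exact hW a ⟨haS, haU⟩ (haW.resolve_right fun h => h haU) b ⟨hbS, hbU⟩ hab
      · by_cases hbv : b = v
        · exact hbv ▸ hvW
        · exact absurd hab.symm (hU b (hbU.resolve_left hbv) a haS (fun h => haU (Or.inr h))
            (fun h => haU (Or.inl h)))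
    · exact Or.inr hbU)
  rintro y ⟨hyS, hyU⟩
  exact (this hyS).resolve_right fun h => h hyU

/-- Disjoint connected subsets of a connected set can be enlarged to a partition of it into
connected sets. -/
theorem ConnSet.exists_spanning [Finite V] {ι : Type} [Finite ι] [Nonempty ι] (hS : ConnSet G S)
    (f : ι → Set V) (hc : ∀ i, ConnSet G (f i)) (hd : ∀ i j, i ≠ j → Disjoint (f i) (f j))
    (hs : ∀ i, f i ⊆ S) :
    ∃ g : ι → Set V, (∀ i, f i ⊆ g i) ∧ (∀ i, ConnSet G (g i)) ∧
      (∀ i j, i ≠ j → Disjoint (g i) (g j)) ∧ ⋃ i, g i = S := by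
  classical
  obtain ⟨g, ⟨hg1, hg2, hg3, hg4⟩, hmax⟩ := Set.Finite.exists_maximalFor
    (fun g : ι → Set V => (⋃ i, g i).ncard)
    {g | (∀ i, f i ⊆ g i) ∧ (∀ i, ConnSet G (g i)) ∧ (∀ i j, i ≠ j → Disjoint (g i) (g j)) ∧
      ∀ i, g i ⊆ S} (Set.toFinite _) ⟨f, fun i => subset_rfl, hc, hd, hs⟩
  refine ⟨g, hg1, hg2, hg3, ?_⟩
  by_contra hne
  have hsub : ⋃ i, g i ⊆ S := Set.iUnion_subset hg4
  obtain ⟨i₀⟩ := ‹Nonempty ι›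
  obtain ⟨x, hx⟩ := (hg2 i₀).1
  obtain ⟨y, hyS, hy⟩ := Set.exists_of_ssubset (hsub.ssubset_of_ne hne)
  obtain ⟨a, haS, haU, b, hbS, hbU, hab⟩ := hS.cross (U := ⋃ i, g i)
    ⟨x, hg4 i₀ hx, Set.mem_iUnion.2 ⟨i₀, hx⟩⟩ ⟨y, hyS, hy⟩
  obtain ⟨i, hi⟩ := Set.mem_iUnion.1 haU
  have hb : ∀ j, b ∉ g j := fun j hj => hbU (Set.mem_iUnion.2 ⟨j, hj⟩)
  have hle : ∀ j, g j ⊆ Function.update g i (g i ∪ {b}) j := by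
    intro j
    by_cases hj : j = i
    · subst hj; simp
    · simp [hj]
  have hmem : Function.update g i (g i ∪ {b}) ∈ {g | (∀ i, f i ⊆ g i) ∧ (∀ i, ConnSet G (g i)) ∧
      (∀ i j, i ≠ j → Disjoint (g i) (g j)) ∧ ∀ i, g i ⊆ S} := by
    refine ⟨fun j => (hg1 j).trans (hle j), ?_, ?_, ?_⟩
    · intro j
      by_cases hj : j = i
      · subst hj
        simpa using (hg2 j).union (connSet_singleton b) ⟨a, hi, b, rfl, hab⟩
      · simpa [hj] using hg2 j
    · intro j k hjk
      by_cases hj : j = i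
      · subst hj
        simpa [hjk.symm, hb k] using hg3 _ _ hjk
      · by_cases hk : k = i
        · subst hk
          simpa [hjk, hb j] using hg3 _ _ hjk
        · simpa [hj, hk] using hg3 _ _ hjk
    · intro j
      by_cases hj : j = i
      · subst hj
        simpa [Set.insert_subset_iff, hbS] using hg4 j
      · simpa [hj] using hg4 j
  have hlt : (⋃ j, g j).ncard < (⋃ j, Function.update g i (g i ∪ {b}) j).ncard := by
    refine Set.ncard_lt_ncard ⟨Set.iUnion_mono hle, fun h => hbU (h ?_)⟩
    exact Set.mem_iUnion.2 ⟨i, by simp⟩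
  exact absurd (hmax hmem hlt.le) (not_le.2 hlt)

/-- A connected set containing two disjoint connected sets splits into two connected parts
that contain them. -/
theorem ConnSet.exists_split [Finite V] (hS : ConnSet G S) (hA : ConnSet G A) (hB : ConnSet G B)
    (hd : Disjoint A B) (hAS : A ⊆ S) (hBS : B ⊆ S) :
    ∃ P Q : Set V, A ⊆ P ∧ B ⊆ Q ∧ ConnSet G P ∧ ConnSet G Q ∧ Disjoint P Q ∧ P ∪ Q = S ∧
      Touch G P Q := by
  obtain ⟨g, h1, h2, h3, h4⟩ := hS.exists_spanning (fun b : Bool => if b then A else B)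
    (by simp [hA, hB]) (by simp [hd, hd.symm]) (by simp [hAS, hBS])
  have hu : g true ∪ g false = S := by
    rw [← h4]; ext x; simp [Set.mem_iUnion, or_comm]
  have hdisj := h3 true false (by simp)
  refine ⟨g true, g false, by simpa using h1 true, by simpa using h1 false, h2 _, h2 _,
    hdisj, hu, ?_⟩
  obtain ⟨x, hx⟩ := (h2 true).1
  obtain ⟨y, hy⟩ := (h2 false).1
  obtain ⟨a, -, ha, b, hb, hb', hab⟩ := hS.cross (U := g true)
    ⟨x, hu ▸ Or.inl hx, hx⟩ ⟨y, hu ▸ Or.inr hy, fun h => Set.disjoint_left.1 hdisj h hy⟩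
  rw [← hu] at hb
  exact ⟨a, ha, b, hb.resolve_left hb', hab⟩

end Connectivity

section Pseudoforests

variable {V W : Type} {G : SimpleGraph V}

theorem Pseudoforest.of_embedding {H : SimpleGraph W} (f : H ↪g G) (h : Pseudoforest G) :
    Pseudoforest H := by
  intro u v c c' hc hc' hr e
  have key := h (c.map f.toHom) (c'.map f.toHom)
    ((Walk.isCycle_map_iff_of_injective f.injective).2 hc)
    ((Walk.isCycle_map_iff_of_injective f.injective).2 hc') (hr.map f.toHom) (e.map f)
  have hm : ∀ (l : List (Sym2 W)), Sym2.map f e ∈ l.map (Sym2.map f) ↔ e ∈ l := fun l =>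
    List.mem_map_of_injective (Sym2.map.injective f.injective)
  simpa [Walk.edges_map, hm] using key

theorem Pseudoforest.induce_mono {S T : Set V} (hST : S ⊆ T)
    (h : Pseudoforest (G.induce T)) : Pseudoforest (G.induce S) :=
  h.of_embedding (G.induceHomOfLE hST)

/-- Cycles through the edge `s(a, b)` arise from paths from `b` to `a` avoiding it. -/
theorem exists_path_of_mem_edges_cycle {a b u : V} (c : G.Walk u u) (hc : c.IsCycle)
    (he : s(a, b) ∈ c.edges) :
    ∃ p : G.Walk b a, p.IsPath ∧ s(a, b) ∉ p.edges ∧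
      ∀ e, e ∈ c.edges ↔ e = s(a, b) ∨ e ∈ p.edges := by
  classical
  have ha : a ∈ c.support := c.fst_mem_support_of_mem_edges he
  have hc1 := hc.rotate ha
  have hedge : ∀ e, e ∈ c.edges ↔ e ∈ (c.rotate a ha).edges := fun e =>
    ((c.rotate_edges a ha).perm.mem_iff).symm
  rw [hedge] at he
  simp only [hedge]
  generalize c.rotate a ha = d at *
  cases d with
  | nil => simp at he
  | @cons _ x _ h p =>
    rw [Walk.cons_isCycle_iff] at hc1
    by_cases hx : x = b
    · subst hx
      exact ⟨p, hc1.1, hc1.2, by simp⟩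
    · have hep : s(a, b) ∈ p.edges := by
        simp only [Walk.edges_cons, List.mem_cons] at he
        rcases he with he | he
        · exact absurd (Sym2.congr_right.1 he).symm hx
        · exact he
      have hrp : p.reverse.IsPath := hc1.1.reverse
      have hre : ∀ e, e ∈ p.edges ↔ e ∈ p.reverse.edges := by simp
      rw [hre] at hep
      have hax := hc1.2
      rw [hre] at hax
      simp only [Walk.edges_cons, List.mem_cons, hre]
      generalize p.reverse = q at *
      cases q with
      | nil => simp at hep
      | @cons _ y _ h' q =>
        rw [Walk.cons_isPath_iff] at hrp
        have hy : y = b := by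
          simp only [Walk.edges_cons, List.mem_cons] at hep
          rcases hep with hep | hep
          · have := Sym2.congr_right.1 hep
            exact this.symm
          · exact absurd (q.fst_mem_support_of_mem_edges hep) hrp.2
        subst hy
        refine ⟨q.concat h.symm, hrp.1.concat hrp.2 _, ?_, ?_⟩
        · simp only [Walk.edges_concat, List.concat_eq_append, List.mem_append, List.mem_singleton]
          rintro (h1 | h1)
          · exact hrp.2 (q.fst_mem_support_of_mem_edges h1)
          · rw [Sym2.eq_swap (a := x), Sym2.congr_right] at h1
            exact hx h1.symm
        · intro e
          simp only [Walk.edges_concat, List.concat_eq_append, List.mem_append,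
            Walk.edges_cons, List.mem_cons]
          rw [Sym2.eq_swap (a := x)]
          tauto

/-- A graph that becomes acyclic after deleting one edge is a pseudoforest. -/
theorem pseudoforest_of_isAcyclic_deleteEdges (e : Sym2 V)
    (h : (G.deleteEdges {e}).IsAcyclic) : Pseudoforest G := by
  have hmem : ∀ {u : V} (c : G.Walk u u), c.IsCycle → e ∈ c.edges := by
    intro u c hc
    by_contra he
    exact h (c.toDeleteEdges {e} (by rintro f hf rfl; exact he hf)) (hc.toDeleteEdges _ _ _)
  induction e with
  | _ a b =>
    intro u v c c' hc hc' _ f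
    obtain ⟨p, hp, hpe, hpc⟩ := exists_path_of_mem_edges_cycle c hc (hmem c hc)
    obtain ⟨q, hq, hqe, hqc⟩ := exists_path_of_mem_edges_cycle c' hc' (hmem c' hc')
    have h1 : ∀ f ∈ p.edges, f ∉ ({s(a, b)} : Set (Sym2 V)) := by
      rintro f hf rfl; exact hpe hf
    have h2 : ∀ f ∈ q.edges, f ∉ ({s(a, b)} : Set (Sym2 V)) := by
      rintro f hf rfl; exact hqe hf
    have := (h.subsingleton_path b a).elim ⟨p.toDeleteEdges _ h1, hp.toDeleteEdges _ _ h1⟩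
      ⟨q.toDeleteEdges _ h2, hq.toDeleteEdges _ _ h2⟩
    have := congrArg (fun r : (G.deleteEdges {s(a, b)}).Path b a => r.1.edges) this
    simp only [Walk.toDeleteEdges, Walk.edges_transfer] at this
    rw [hpc, hqc, this]

theorem not_isAcyclic_of_not_pseudoforest (h : ¬ Pseudoforest G) : ¬ G.IsAcyclic := fun ha =>
  h fun _ _ c _ hc _ _ _ => absurd hc (ha c)

theorem Pseudoforest.induce_induce {S S' : Set V} {T : Set S} (hT : ∀ x ∈ T, (x : V) ∈ S')
    (h : Pseudoforest (G.induce S')) : Pseudoforest ((G.induce S).induce T) := by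
  let f : (G.induce S).induce T ↪g G.induce S' :=
    { toFun := fun x => ⟨x.1.1, hT _ x.2⟩
      inj' := by
        intro x y hxy
        simpa [Subtype.ext_iff] using hxy
      map_rel_iff' := by
        intros
        exact Iff.rfl }
  exact h.of_embedding f

theorem Pseudoforest.mem_edges_iff {T : Set V} (h : Pseudoforest (G.induce T)) {u v : V}
    {c : G.Walk u u} {c' : G.Walk v v} (hc : c.IsCycle) (hc' : c'.IsCycle) (p : G.Walk u v)
    (h1 : ∀ y ∈ c.support, y ∈ T) (h2 : ∀ y ∈ c'.support, y ∈ T) (h3 : ∀ y ∈ p.support, y ∈ T)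
    (e : Sym2 V) : e ∈ c.edges ↔ e ∈ c'.edges := by
  have hcyc : ∀ {x : V} (d : G.Walk x x) (hd : ∀ y ∈ d.support, y ∈ T), d.IsCycle →
      (d.induce T hd).IsCycle := by
    intro x d hd hdc
    have : ((d.induce T hd).map (Embedding.induce _).toHom).IsCycle := by
      rwa [Walk.map_induce]
    exact this.of_map
  have hb : ∀ {x : V} (d : G.Walk x x) (hd),
      e ∈ d.edges ↔ ∃ e', e' ∈ (d.induce T hd).edges ∧
        Sym2.map (Embedding.induce (G := G) T).toHom e' = e := by
    intro x d hd
    have h0 : (d.induce T hd).edges.map (Sym2.map (Embedding.induce (G := G) T).toHom) = d.edges :=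
      (Walk.edges_map _ _).symm.trans (congrArg Walk.edges (Walk.map_induce d hd))
    rw [← h0, List.mem_map]
  rw [hb c h1, hb c' h2]
  have := h (c.induce T h1) (c'.induce T h2) (hcyc c h1 hc) (hcyc c' h2 hc') ⟨p.induce T h3⟩
  simp only [this]

theorem exists_connSet_not_pseudoforest {S : Set V} (h : ¬ Pseudoforest (G.induce S)) :
    ∃ T ⊆ S, ConnSet G T ∧ (∀ a ∈ T, ∀ b ∈ S, G.Adj a b → b ∈ T) ∧
      ¬ Pseudoforest (G.induce T) := by
  unfold Pseudoforest at h
  simp only [not_forall] at h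
  obtain ⟨u, v, c, c', hc, hc', hr, e, he⟩ := h
  obtain ⟨K, hKS, huK, hK, hcl⟩ := exists_component (G := G) u.2
  refine ⟨K, hKS, hK, hcl, fun hpf => ?_⟩
  have key : ∀ {x y : S} (p : (G.induce S).Walk x y), (x : V) ∈ K → ∀ z ∈ p.support, (z : V) ∈ K := by
    intro x y p
    induction p with
    | nil => simp +contextual
    | @cons x y z hadj p ih =>
      intro hx z hz
      rw [Walk.support_cons, List.mem_cons] at hz
      rcases hz with rfl | hz
      · exact hx
      · exact ih (hcl _ hx _ (Subtype.coe_prop _) hadj) _ hz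
  obtain ⟨p⟩ := hr
  have hvK : (v : V) ∈ K := key p huK v p.end_mem_support
  exact he ((hpf.induce_induce (T := {x : S | (x : V) ∈ K}) fun _ hx => hx).mem_edges_iff hc hc' p
    (key c huK) (key c' hvK) (key p huK) e)

/-- Removing a vertex with at most one neighbour does not destroy non-pseudoforests. -/
theorem not_pseudoforest_sdiff_leaf {S : Set V} {x : V}
    (hleaf : ∀ a ∈ S, ∀ b ∈ S, G.Adj x a → G.Adj x b → a = b)
    (h : ¬ Pseudoforest (G.induce S)) : ¬ Pseudoforest (G.induce (S \ {x})) := by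
  classical
  by_cases hx : x ∈ S
  swap
  · rwa [Set.sdiff_singleton_eq_self hx]
  intro hpf
  apply h
  have hcyc : ∀ {u : S} (c : (G.induce S).Walk u u), c.IsCycle → ⟨x, hx⟩ ∉ c.support := by
    intro u c hc hxc
    have := hc.ncard_neighborSet_toSubgraph_eq_two hxc
    obtain ⟨a, b, hab, hset⟩ := Set.ncard_eq_two.1 this
    have ha : a ∈ c.toSubgraph.neighborSet ⟨x, hx⟩ := by simp [hset]
    have hb : b ∈ c.toSubgraph.neighborSet ⟨x, hx⟩ := by simp [hset]
    have ha' : (G.induce S).Adj ⟨x, hx⟩ a := c.toSubgraph.adj_sub ha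
    have hb' : (G.induce S).Adj ⟨x, hx⟩ b := c.toSubgraph.adj_sub hb
    exact hab (Subtype.ext (hleaf a a.2 b b.2 ha' hb'))
  have hpath : ∀ {u v : S} (p : (G.induce S).Walk u v), p.IsPath → u ≠ ⟨x, hx⟩ → v ≠ ⟨x, hx⟩ →
      ⟨x, hx⟩ ∉ p.support := by
    intro u v p
    induction p with
    | nil => intro _ h1 _ h2; simp at h2; exact h1 h2.symm
    | @cons u w v hadj p ih =>
      intro hp hu hv hxp
      rw [Walk.cons_isPath_iff] at hp
      rw [Walk.support_cons, List.mem_cons] at hxp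
      have hxp' := hxp.resolve_left (Ne.symm hu)
      by_cases hw : w = ⟨x, hx⟩
      · subst hw
        cases p with
        | nil => exact hv rfl
        | @cons _ y _ hadj' q =>
          apply hp.2
          have : u = y := Subtype.ext (hleaf u u.2 y y.2 hadj.symm hadj')
          rw [this]
          simp
      · exact ih hp.1 hw hv hxp'
  let T : Set S := {y | (y : V) ≠ x}
  have hpf' : Pseudoforest ((G.induce S).induce T) :=
    hpf.induce_induce fun y hy => Set.mem_sdiff_singleton.2 ⟨y.2, hy⟩
  intro u v c c' hc hc' hr e
  have hT : ∀ {u v : S} (p : (G.induce S).Walk u v), ⟨x, hx⟩ ∉ p.support → ∀ y ∈ p.support, y ∈ T := by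
    intro u v p hp y hy hyx
    exact hp (by convert hy; exact hyx.symm)
  have h1 := hT c (hcyc c hc)
  have h2 := hT c' (hcyc c' hc')
  obtain ⟨p, hp⟩ := hr.exists_isPath
  have hne : ∀ {u : S} (c : (G.induce S).Walk u u), c.IsCycle → u ≠ ⟨x, hx⟩ := by
    rintro u c hc rfl
    exact hcyc c hc c.start_mem_support
  have h3 := hT p (hpath p hp (hne c hc) (hne c' hc'))
  exact hpf'.mem_edges_iff hc hc' p h1 h2 h3 e

end Pseudoforests

section Triangles

variable {V : Type} {G : SimpleGraph V} {S P Q : Set V}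

/-- Acyclicity of an induced subgraph in terms of edge cuts consisting of a single edge. -/
theorem isAcyclic_induce_iff : (G.induce S).IsAcyclic ↔
    ∀ a ∈ S, ∀ b ∈ S, G.Adj a b → ∃ U : Set V, a ∈ U ∧ b ∉ U ∧
      ∀ x ∈ S, x ∈ U → ∀ y ∈ S, y ∉ U → G.Adj x y → x = a ∧ y = b := by
  rw [isAcyclic_iff_forall_adj_isBridge]
  constructor
  · intro h a ha b hb hab
    have hbr := h (v := ⟨a, ha⟩) (w := ⟨b, hb⟩) hab
    rw [isBridge_iff] at hbr
    refine ⟨{x | ∃ hx : x ∈ S, ((G.induce S).deleteEdges {s(⟨a, ha⟩, ⟨b, hb⟩)}).Reachable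
      ⟨a, ha⟩ ⟨x, hx⟩}, ⟨ha, Reachable.refl _⟩, fun ⟨_, h⟩ => hbr h, ?_⟩
    rintro x hx ⟨_, hxr⟩ y hy hyU hxy
    by_contra hne
    apply hyU
    refine ⟨hy, hxr.trans (Adj.reachable ?_)⟩
    rw [deleteEdges_adj]
    refine ⟨hxy, fun heq => ?_⟩
    rw [Set.mem_singleton_iff, Sym2.eq_iff] at heq
    rcases heq with ⟨h1, h2⟩ | ⟨h1, h2⟩
    · exact hne ⟨congrArg Subtype.val h1, congrArg Subtype.val h2⟩
    · obtain rfl : y = a := congrArg Subtype.val h2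
      exact hyU ⟨ha, Reachable.refl _⟩
  · intro h v w hvw
    rw [isBridge_iff]
    obtain ⟨U, ha, hb, hU⟩ := h v v.2 w w.2 hvw
    rintro ⟨p⟩
    have key : ∀ {x y : S} (p : ((G.induce S).deleteEdges {s(v, w)}).Walk x y),
        (x : V) ∈ U → (y : V) ∈ U := by
      intro x y p
      induction p with
      | nil => exact id
      | @cons x y z hadj p ih =>
        intro hx
        apply ih
        by_contra hy
        rw [deleteEdges_adj] at hadj
        obtain ⟨h1, h2⟩ := hU x x.2 hx y y.2 hy hadj.1
        apply hadj.2
        rw [Subtype.ext h1, Subtype.ext h2]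
        rfl
    exact hb (key p ha)

theorem isAcyclic_induce_union (hd : Disjoint P Q) (hP : (G.induce P).IsAcyclic)
    (hQ : (G.induce Q).IsAcyclic)
    (h1 : ∀ p ∈ P, ∀ q ∈ Q, ∀ p' ∈ P, ∀ q' ∈ Q, G.Adj p q → G.Adj p' q' → p = p' ∧ q = q') :
    (G.induce (P ∪ Q)).IsAcyclic := by
  rw [isAcyclic_induce_iff] at hP hQ ⊢
  have hPQ : ∀ x ∈ P, x ∉ Q := fun x hx hx' => Set.disjoint_left.1 hd hx hx'
  rintro a (ha | ha) b (hb | hb) hab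
  · obtain ⟨U, haU, hbU, hU⟩ := hP a ha b hb hab
    refine ⟨{x | (x ∈ P ∧ x ∈ U) ∨ (x ∈ Q ∧ ∃ p ∈ P, p ∈ U ∧ ∃ q ∈ Q, G.Adj p q)}, ?_, ?_, ?_⟩
    · simp only [Set.mem_ofPred_eq]
      grind
    · simp only [Set.mem_ofPred_eq]
      grind
    · simp only [Set.mem_ofPred_eq]
      rintro x - (⟨hx, hxU⟩ | ⟨hx, p, hp, hpU, q, hq, hpq⟩) y (hy | hy) hyU hxy
      · grind
      · exact absurd (Or.inr ⟨hy, x, hx, hxU, y, hy, hxy⟩) hyU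
      · obtain ⟨rfl, rfl⟩ := h1 _ hp _ hq _ hy _ hx hpq hxy.symm
        exact absurd (Or.inl ⟨hy, hpU⟩) hyU
      · exact absurd (Or.inr ⟨hy, p, hp, hpU, q, hq, hpq⟩) hyU
  · refine ⟨P, ha, fun h => hPQ _ h hb, ?_⟩
    rintro x - hx y (hy | hy) hyP hxy
    · exact absurd hy hyP
    · exact h1 _ hx _ hy _ ha _ hb hxy hab
  · refine ⟨Q, ha, hPQ b hb, ?_⟩
    rintro x - hx y (hy | hy) hyP hxy
    · exact (h1 _ hy _ hx _ hb _ ha hxy.symm hab.symm).symm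
    · exact absurd hy hyP
  · obtain ⟨U, haU, hbU, hU⟩ := hQ a ha b hb hab
    refine ⟨{x | (x ∈ Q ∧ x ∈ U) ∨ (x ∈ P ∧ ∃ q ∈ Q, q ∈ U ∧ ∃ p ∈ P, G.Adj p q)}, ?_, ?_, ?_⟩
    · simp only [Set.mem_ofPred_eq]
      grind
    · simp only [Set.mem_ofPred_eq]
      grind
    · simp only [Set.mem_ofPred_eq]
      rintro x - (⟨hx, hxU⟩ | ⟨hx, q, hq, hqU, p, hp, hpq⟩) y (hy | hy) hyU hxy
      · exact absurd (Or.inr ⟨hy, x, hx, hxU, y, hy, hxy.symm⟩) hyU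
      · grind
      · exact absurd (Or.inr ⟨hy, q, hq, hqU, p, hp, hpq⟩) hyU
      · obtain ⟨rfl, rfl⟩ := h1 _ hp _ hq _ hx _ hy hpq hxy
        exact absurd (Or.inl ⟨hy, hqU⟩) hyU

/-- Three pairwise disjoint connected pairwise touching sets. -/
structure TriangleModel (G : SimpleGraph V) (X Y Z : Set V) : Prop where
  conn₁ : ConnSet G X
  conn₂ : ConnSet G Y
  conn₃ : ConnSet G Z
  disj₁₂ : Disjoint X Y
  disj₁₃ : Disjoint X Z
  disj₂₃ : Disjoint Y Z
  touch₁₂ : Touch G X Y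
  touch₁₃ : Touch G X Z
  touch₂₃ : Touch G Y Z

theorem TriangleModel.rotate {X Y Z : Set V} (h : TriangleModel G X Y Z) :
    TriangleModel G Y Z X :=
  ⟨h.conn₂, h.conn₃, h.conn₁, h.disj₂₃, h.disj₁₂.symm, h.disj₁₃.symm, h.touch₂₃,
    h.touch₁₂.symm, h.touch₁₃.symm⟩

theorem TriangleModel.swap {X Y Z : Set V} (h : TriangleModel G X Y Z) :
    TriangleModel G X Z Y :=
  ⟨h.conn₁, h.conn₃, h.conn₂, h.disj₁₃, h.disj₁₂, h.disj₂₃.symm, h.touch₁₃,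
    h.touch₁₂, h.touch₂₃.symm⟩

/-- Two vertices of `X` have neighbours in `Y`. -/
def DoubleTouch (G : SimpleGraph V) (X Y : Set V) : Prop :=
  ∃ a ∈ X, ∃ b ∈ X, a ≠ b ∧ Touch G {a} Y ∧ Touch G {b} Y

theorem eq_of_not_doubleTouch {X Y : Set V} (h1 : ¬ DoubleTouch G X Y) (h2 : ¬ DoubleTouch G Y X) :
    ∀ p ∈ X, ∀ q ∈ Y, ∀ p' ∈ X, ∀ q' ∈ Y, G.Adj p q → G.Adj p' q' → p = p' ∧ q = q' := by
  intro p hp q hq p' hp' q' hq' h h'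
  constructor
  · by_contra hne
    exact h1 ⟨p, hp, p', hp', hne, ⟨p, rfl, q, hq, h⟩, ⟨p', rfl, q', hq', h'⟩⟩
  · by_contra hne
    exact h2 ⟨q, hq, q', hq', hne, ⟨q, rfl, p, hp, h.symm⟩, ⟨q', rfl, p', hp', h'.symm⟩⟩

/-- If three disjoint sets cover a graph that is not a pseudoforest, then one of them has a cycle
or one of them is joined to another one by two vertices. -/
theorem exists_not_isAcyclic_or_doubleTouch {X Y Z : Set V} (h₁₂ : Disjoint X Y)
    (h₁₃ : Disjoint X Z) (h₂₃ : Disjoint Y Z) (h : ¬ Pseudoforest (G.induce (X ∪ Y ∪ Z))) :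
    (¬ (G.induce X).IsAcyclic ∨ ¬ (G.induce Y).IsAcyclic ∨ ¬ (G.induce Z).IsAcyclic) ∨
    (DoubleTouch G X Y ∨ DoubleTouch G X Z ∨ DoubleTouch G Y Z ∨
      DoubleTouch G Y X ∨ DoubleTouch G Z X ∨ DoubleTouch G Z Y) := by
  by_contra! hc
  obtain ⟨⟨hX, hY, hZ⟩, hXY, hXZ, hYZ, hYX, hZX, hZY⟩ := hc
  have e₁₂ := eq_of_not_doubleTouch hXY hYX
  have e₁₃ := eq_of_not_doubleTouch hXZ hZX
  have e₂₃ := eq_of_not_doubleTouch hYZ hZY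
  have ac : ∀ H ≤ G, (∀ x ∈ X, ∀ y ∈ Y, ¬ H.Adj x y) → (H.induce (X ∪ Y ∪ Z)).IsAcyclic := by
    intro H le no
    have mono : ∀ {P : Set V}, (G.induce P).IsAcyclic → (H.induce P).IsAcyclic :=
      fun hP => hP.anti fun _ _ hxy => le hxy
    rw [Set.union_right_comm]
    refine isAcyclic_induce_union (Set.disjoint_union_left.2 ⟨h₁₂, h₂₃.symm⟩)
      (isAcyclic_induce_union h₁₃ (mono hX) (mono hZ) ?_) (mono hY) ?_
    · intro p hp q hq p' hp' q' hq' h h'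
      exact e₁₃ p hp q hq p' hp' q' hq' (le h) (le h')
    · rintro p (hp | hp) q hq p' (hp' | hp') q' hq' h h'
      · exact absurd h (no p hp q hq)
      · exact absurd h (no p hp q hq)
      · exact absurd h' (no _ hp' _ hq')
      · exact (e₂₃ q hq p hp q' hq' p' hp' (le h).symm (le h').symm).symm
  by_cases ht : Touch G X Y
  · obtain ⟨a, ha, b, hb, hab⟩ := ht
    refine h (pseudoforest_of_isAcyclic_deleteEdges
      s(⟨a, Or.inl (Or.inl ha)⟩, ⟨b, Or.inl (Or.inr hb)⟩)
      ((ac (G.deleteEdges {s(a, b)}) (deleteEdges_le _) ?_).anti ?_))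
    · intro x hx y hy hxy
      rw [deleteEdges_adj] at hxy
      obtain ⟨rfl, rfl⟩ := e₁₂ x hx y hy a ha b hb hxy.1 hab
      exact hxy.2 rfl
    · intro x y hxy
      rw [deleteEdges_adj] at hxy
      refine (deleteEdges_adj).2 ⟨hxy.1, fun heq => hxy.2 ?_⟩
      rw [Set.mem_singleton_iff, Sym2.eq_iff] at heq ⊢
      simpa [Subtype.ext_iff] using heq
  · exact not_isAcyclic_of_not_pseudoforest h
      (ac G le_rfl fun x hx y hy hxy => ht ⟨x, hx, y, hy, hxy⟩)

/-- A connected set with a cycle has a spanning triangle model. -/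
theorem ConnSet.exists_triangleModel [Finite V] (hS : ConnSet G S)
    (h : ¬ (G.induce S).IsAcyclic) : ∃ X Y Z, TriangleModel G X Y Z ∧ X ∪ Y ∪ Z = S := by
  rw [isAcyclic_induce_iff] at h
  push Not at h
  obtain ⟨a, ha, b, hb, hab, hU⟩ := h
  have hK : ∃ K ⊆ S \ {a, b}, ConnSet G K ∧ Touch G {a} K ∧ Touch G {b} K := by
    obtain ⟨x, hxS, hxU, y, hyS, hyU, hxy, hne⟩ := hU
      (insert a {x | ∃ K ⊆ S \ {a, b}, x ∈ K ∧ Touch G {a} K ∧ ConnSet G K ∧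
        ∀ c ∈ K, ∀ d ∈ S \ {a, b}, G.Adj c d → d ∈ K}) (Or.inl rfl) (by
        rintro (rfl | ⟨K, hK, hbK, -⟩)
        · exact hab.ne rfl
        · exact (hK hbK).2 (Or.inr rfl))
    have hya : y ≠ a := fun h => hyU (Or.inl h)
    rcases hxU with rfl | ⟨K, hK, hxK, hT, hKc, hcl⟩
    · have hyb := hne rfl
      obtain ⟨K, hKS, hyK, hK, hcl⟩ := exists_component (G := G) (S := S \ {x, b}) (v := y)
        ⟨hyS, by simp [hya, hyb]⟩
      exact absurd (Or.inr ⟨K, hKS, hyK, ⟨x, rfl, y, hyK, hxy⟩, hK, hcl⟩) hyU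
    · by_cases hyb : y = b
      · subst hyb
        exact ⟨K, hK, hKc, hT, ⟨y, rfl, x, hxK, hxy.symm⟩⟩
      · exact absurd (Or.inr ⟨K, hK, hcl x hxK y ⟨hyS, by simp [hya, hyb]⟩ hxy, hT, hKc, hcl⟩) hyU
  obtain ⟨K, hKS, hK, hKa, hKb⟩ := hK
  have hT : Touch G {a} {b} := ⟨a, rfl, b, rfl, hab⟩
  have haK : a ∉ K := fun h => (hKS h).2 (Or.inl rfl)
  have hbK : b ∉ K := fun h => (hKS h).2 (Or.inr rfl)
  obtain ⟨g, hg1, hg2, hg3, hg4⟩ := hS.exists_spanning ![{a}, {b}, K]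
    (by simp [Fin.forall_fin_succ, connSet_singleton, hK])
    (by simp [Fin.forall_fin_succ, haK, hbK, hab.ne, hab.ne'])
    (by simp [Fin.forall_fin_succ, ha, hb, hKS.trans Set.sdiff_subset])
  refine ⟨g 0, g 1, g 2, ⟨hg2 0, hg2 1, hg2 2, hg3 _ _ (by decide), hg3 _ _ (by decide),
    hg3 _ _ (by decide), Touch.mono hT (hg1 0) (hg1 1),
    hKa.mono (hg1 0) (hg1 2), hKb.mono (hg1 1) (hg1 2)⟩, ?_⟩
  rw [← hg4]
  ext x
  simp [Fin.exists_fin_succ, or_assoc]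

theorem ConnSet.exists_triangleModel_of_mem [Finite V] (hS : ConnSet G S)
    (h : ¬ (G.induce S).IsAcyclic) {v : V} (hv : v ∈ S) :
    ∃ X Y Z, TriangleModel G X Y Z ∧ X ∪ Y ∪ Z = S ∧ v ∈ X := by
  obtain ⟨X, Y, Z, hT, rfl⟩ := hS.exists_triangleModel h
  rcases hv with (hv | hv) | hv
  · exact ⟨X, Y, Z, hT, rfl, hv⟩
  · exact ⟨Y, Z, X, hT.rotate, by ext; simp; tauto, hv⟩
  · exact ⟨Z, X, Y, hT.rotate.rotate, by ext; simp; tauto, hv⟩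

/-- A connected set two of whose vertices touch `A` splits into two connected sets touching `A`. -/
theorem DoubleTouch.exists_split [Finite V] {A : Set V} (hS : ConnSet G S)
    (h : DoubleTouch G S A) :
    ∃ P Q, ConnSet G P ∧ ConnSet G Q ∧ Disjoint P Q ∧ P ∪ Q = S ∧ Touch G P Q ∧
      Touch G P A ∧ Touch G Q A := by
  obtain ⟨a, ha, b, hb, hab, hta, htb⟩ := h
  obtain ⟨P, Q, haP, hbQ, hP, hQ, hd, hu, hPQ⟩ := hS.exists_split (connSet_singleton a)
    (connSet_singleton b) (by simpa using hab) (by simpa using ha) (by simpa using hb)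
  exact ⟨P, Q, hP, hQ, hd, hu, hPQ, hta.mono haP subset_rfl, htb.mono hbQ subset_rfl⟩

end Triangles

section Obstructions

variable {V W : Type} {G : SimpleGraph V} {H : SimpleGraph W}

theorem SimpleGraph.Walk.IsPath.isCycle_cons {a b : W} {p : H.Walk a b} (hp : p.IsPath)
    (h : H.Adj b a) (hl : 2 ≤ p.length) : (Walk.cons h p).IsCycle := by
  rw [Walk.cons_isCycle_iff]
  refine ⟨hp, fun he => ?_⟩
  cases p with
  | nil => simp at hl
  | @cons _ x _ hax q =>
    rw [Walk.cons_isPath_iff] at hp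
    rw [Walk.edges_cons, List.mem_cons] at he
    rcases he with he | he
    · rw [Sym2.eq_swap, Sym2.congr_right] at he
      subst he
      rw [Walk.isPath_iff_nil, ← Walk.length_eq_zero_iff] at hp
      simp [hp.1] at hl
    · exact hp.2 (q.snd_mem_support_of_mem_edges he)

theorem exists_walk_of_isChain {a b : W} {l : List W} (h : (a :: l).IsChain H.Adj)
    (hb : (a :: l).getLast (List.cons_ne_nil _ _) = b) :
    ∃ p : H.Walk a b, p.support = a :: l := by
  subst hb
  exact ⟨Walk.ofSupport _ (List.cons_ne_nil _ _) h, Walk.support_ofSupport _ _⟩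

/-- The list `a :: l` is the list of vertices of a cycle avoiding `x`. -/
def IsCycleList (H : SimpleGraph W) (x a : W) (l : List W) : Prop :=
  (a :: l).Nodup ∧ 2 ≤ l.length ∧ (a :: l).IsChain H.Adj ∧
    H.Adj ((a :: l).getLast (List.cons_ne_nil _ _)) a ∧ x ∉ a :: l

theorem IsCycleList.exists_isCycle {x a : W} {l : List W} (h : IsCycleList H x a l) :
    ∃ c : H.Walk ((a :: l).getLast (List.cons_ne_nil _ _)) ((a :: l).getLast (List.cons_ne_nil _ _)),
      c.IsCycle ∧ ∀ y, y ∈ c.support ↔ y ∈ a :: l := by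
  obtain ⟨h1, h2, h3, h4, h5⟩ := h
  obtain ⟨p, hp⟩ := exists_walk_of_isChain h3 rfl
  refine ⟨Walk.cons h4 p, Walk.IsPath.isCycle_cons ?_ _ ?_, fun y => ?_⟩
  · rwa [Walk.isPath_def, hp]
  · have := p.length_support
    simp only [hp, List.length_cons] at this
    omega
  · rw [Walk.support_cons, List.mem_cons, hp, or_iff_right_iff_imp]
    rintro rfl
    exact List.getLast_mem _

/-- Two cycles avoiding `x` joined by a walk avoiding `x`. -/
def IsTwoCycles (H : SimpleGraph W) (x : W) (t : (W × List W) × (W × List W) × List W) : Prop :=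
  IsCycleList H x t.1.1 t.1.2 ∧ IsCycleList H x t.2.1.1 t.2.1.2 ∧
  ((t.1.1 :: t.1.2).getLast (List.cons_ne_nil _ _) :: t.2.2).IsChain H.Adj ∧
  ((t.1.1 :: t.1.2).getLast (List.cons_ne_nil _ _) :: t.2.2).getLast (List.cons_ne_nil _ _) =
    (t.2.1.1 :: t.2.1.2).getLast (List.cons_ne_nil _ _) ∧
  x ∉ t.2.2 ∧ ∃ y ∈ t.1.1 :: t.1.2, y ∉ t.2.1.1 :: t.2.1.2

instance [DecidableEq W] [DecidableRel H.Adj] (x : W) (t) : Decidable (IsTwoCycles H x t) := by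
  unfold IsTwoCycles IsCycleList
  infer_instance

theorem IsTwoCycles.not_pseudoforest {x : W} {t} (h : IsTwoCycles H x t) :
    ¬ Pseudoforest (H.induce {x}ᶜ) := by
  obtain ⟨hc, hd, h1, h2, h3, y, hy, hy'⟩ := h
  intro hpf
  obtain ⟨c, hcc, hcs⟩ := hc.exists_isCycle
  obtain ⟨d, hdc, hds⟩ := hd.exists_isCycle
  have hx : ∀ {l : List W}, x ∉ l → ∀ y ∈ l, y ∈ ({x}ᶜ : Set W) := by
    rintro l hl y hy rfl
    exact hl hy
  obtain ⟨p, hp⟩ := exists_walk_of_isChain h1 h2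
  have key := hpf.mem_edges_iff hcc hdc p
    (fun y hy => hx hc.2.2.2.2 y ((hcs y).1 hy)) (fun y hy => hx hd.2.2.2.2 y ((hds y).1 hy))
    (by
      rw [hp]
      intro y hy
      rcases List.mem_cons.1 hy with rfl | hy
      · exact hx hc.2.2.2.2 _ (List.getLast_mem _)
      · exact hx h3 y hy)
  rw [← hcs, Walk.mem_support_iff_exists_mem_edges_of_not_nil hcc.not_nil] at hy
  obtain ⟨e, he, hye⟩ := hy
  rw [← hds, Walk.mem_support_iff_exists_mem_edges_of_not_nil hdc.not_nil] at hy'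
  exact hy' ⟨e, (key e).1 he, hye⟩

theorem not_apexPseudoforest_of_table [Nonempty W] (t : W → (W × List W) × (W × List W) × List W)
    (h : ∀ x, IsTwoCycles H x (t x)) : ¬ ApexPseudoforest H := by
  rintro ⟨s, hs, hpf⟩
  rcases hs.eq_empty_or_singleton with rfl | ⟨x, rfl⟩
  · obtain ⟨x⟩ := ‹Nonempty W›
    exact (h x).not_pseudoforest (hpf.induce_mono (by simp))
  · exact (h x).not_pseudoforest hpf

instance (n : ℕ) (E : List (ℕ × ℕ)) : DecidableRel (mkGraph n E).Adj := fun a b =>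
  decidable_of_iff (a ≠ b ∧ (((a : ℕ), (b : ℕ)) ∈ E ∨ ((b : ℕ), (a : ℕ)) ∈ E)) Iff.rfl

instance : DecidableRel O1.Adj := inferInstanceAs (DecidableRel (mkGraph _ _).Adj)
instance : DecidableRel O2.Adj := inferInstanceAs (DecidableRel (mkGraph _ _).Adj)
instance : DecidableRel O3.Adj := inferInstanceAs (DecidableRel (mkGraph _ _).Adj)
instance : DecidableRel O4.Adj := inferInstanceAs (DecidableRel (mkGraph _ _).Adj)
instance : DecidableRel O7.Adj := inferInstanceAs (DecidableRel (mkGraph _ _).Adj)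
instance : DecidableRel O8.Adj := inferInstanceAs (DecidableRel (mkGraph _ _).Adj)
instance : DecidableRel O31.Adj := inferInstanceAs (DecidableRel (mkGraph _ _).Adj)

theorem not_apexPseudoforest_O1 : ¬ ApexPseudoforest O1 :=
  not_apexPseudoforest_of_table
    (fun x => if x < 4 then ((4, [6, 5]), (4, [7, 5]), []) else ((0, [2, 1]), (0, [3, 1]), []))
    (by decide)

theorem not_apexPseudoforest_O2 : ¬ ApexPseudoforest O2 :=
  not_apexPseudoforest_of_table
    (fun x => if x < 5 then ((6, [7, 5]), (8, [9, 5]), []) else ((1, [2, 0]), (3, [4, 0]), []))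
    (by decide)

theorem not_apexPseudoforest_O3 : ¬ ApexPseudoforest O3 :=
  not_apexPseudoforest_of_table
    (fun x => if x < 4 then ((5, [6, 4]), (7, [8, 4]), []) else ((0, [2, 1]), (0, [3, 1]), []))
    (by decide)

theorem not_apexPseudoforest_O4 : ¬ ApexPseudoforest O4 :=
  not_apexPseudoforest_of_table
    (fun x => if x < 3 then ((3, [4, 5]), (6, [7, 5]), [])
      else if x = 3 then ((0, [1, 2]), (6, [7, 5]), [4, 5])
      else if x = 4 then ((0, [1, 2]), (6, [7, 5]), [3, 5])
      else ((0, [1, 2]), (3, [4, 2]), []))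
    (by decide)

theorem not_apexPseudoforest_O7 : ¬ ApexPseudoforest O7 :=
  not_apexPseudoforest_of_table
    (fun x => if x = 0 ∨ x = 1 ∨ x = 6 then ((4, [3, 2]), (5, [3, 2]), [])
      else if x = 2 then ((0, [1, 6]), (4, [3, 5, 6]), [])
      else if x = 3 then ((0, [1, 6]), (4, [2, 5, 6]), [])
      else if x = 4 then ((0, [1, 6]), (2, [3, 5]), [5])
      else ((0, [1, 6]), (2, [3, 4]), [4]))
    (by decide)

theorem not_apexPseudoforest_O8 : ¬ ApexPseudoforest O8 :=
  not_apexPseudoforest_of_table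
    (fun x => if x < 3 then ((4, [3, 5]), (4, [6, 5]), [])
      else if x = 3 then ((0, [1, 2]), (4, [5, 2]), [])
      else if x = 4 then ((0, [1, 2]), (3, [5, 2]), [])
      else ((0, [1, 2]), (3, [4, 2]), []))
    (by decide)

theorem not_apexPseudoforest_O31 : ¬ ApexPseudoforest O31 :=
  not_apexPseudoforest_of_table
    (fun x => if x = 0 then ((3, [4, 5]), (1, [4, 5, 2]), [2])
      else if x = 1 then ((4, [3, 5]), (0, [3, 5, 2]), [2])
      else if x = 2 then ((5, [3, 4]), (0, [3, 4, 1]), [1])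
      else if x = 3 then ((0, [1, 2]), (1, [4, 5, 2]), [])
      else if x = 4 then ((0, [1, 2]), (0, [3, 5, 2]), [])
      else ((0, [2, 1]), (0, [3, 4, 1]), []))
    (by decide)

/-- Graphs without any of the disconnected obstructions or the obstructions with numbers
4, 7, 8 and 31 as a minor. -/
structure ExcludesMinors (G : SimpleGraph V) : Prop where
  o1 : ¬ IsMinorOf O1 G
  o2 : ¬ IsMinorOf O2 G
  o3 : ¬ IsMinorOf O3 G
  o4 : ¬ IsMinorOf O4 G
  o7 : ¬ IsMinorOf O7 G
  o8 : ¬ IsMinorOf O8 G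
  o31 : ¬ IsMinorOf O31 G

theorem ObsApexPseudoforest.excludesMinors (h1 : ObsApexPseudoforest G) (h2 : ¬ InO G) :
    ExcludesMinors G := by
  have key : ∀ {n : ℕ} (H : SimpleGraph (Fin n)), ⟨n, H⟩ ∈ OList → ¬ ApexPseudoforest H →
      ¬ IsMinorOf H G := by
    intro n H hH hna hm
    refine hna (h1.2 _ H hm ⟨fun e => h2 ⟨⟨n, H⟩, hH, ⟨e.symm⟩⟩⟩)
  exact ⟨key _ (by simp [OList]) not_apexPseudoforest_O1,
    key _ (by simp [OList]) not_apexPseudoforest_O2,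
    key _ (by simp [OList]) not_apexPseudoforest_O3,
    key _ (by simp [OList]) not_apexPseudoforest_O4,
    key _ (by simp [OList]) not_apexPseudoforest_O7,
    key _ (by simp [OList]) not_apexPseudoforest_O8,
    key _ (by simp [OList]) not_apexPseudoforest_O31⟩

/-- A list of pairwise disjoint connected sets yields a minor. -/
theorem isMinorOf_mkGraph (l : List (Set V)) (E : List (ℕ × ℕ)) (hc : ∀ A ∈ l, ConnSet G A)
    (hd : l.Pairwise Disjoint)
    (hE : ∀ e ∈ E, Touch G (l.getD e.1 ∅) (l.getD e.2 ∅)) :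
    IsMinorOf (mkGraph l.length E) G := by
  refine ⟨fun i => l.get i, fun i => connected_induce_iff_connSet.2 (hc _ (List.get_mem _ _)),
    ?_, ?_⟩
  · intro i j hij
    rcases lt_or_gt_of_ne hij with h | h
    · exact List.pairwise_iff_get.1 hd _ _ h
    · exact (List.pairwise_iff_get.1 hd _ _ h).symm
  · rintro i j ⟨-, h | h⟩
    · simpa [Touch] using hE _ h
    · have := (hE _ h).symm
      simpa [Touch] using this

end Obstructions

section Patterns

variable {V : Type} {G : SimpleGraph V}

/-- A triangle model attached at `v` to the set `D`. -/
structure IsPendant (G : SimpleGraph V) (v : V) (D Y₀ Y₁ Y₂ : Set V) : Prop where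
  model : TriangleModel G Y₀ Y₁ Y₂
  mem : v ∈ Y₀
  inter₀ : Y₀ ∩ D ⊆ {v}
  disj₁ : Disjoint Y₁ D
  disj₂ : Disjoint Y₂ D

variable {v : V} {D Y₀ Y₁ Y₂ : Set V}

theorem IsPendant.facts (h : IsPendant G v D Y₀ Y₁ Y₂) {M : Set V} (hM : ConnSet G M)
    (hv : v ∈ M) (hMD : M ⊆ D) :
    ConnSet G (M ∪ Y₀) ∧ Disjoint Y₁ Y₂ ∧ Disjoint Y₁ (M ∪ Y₀) ∧ Disjoint Y₂ (M ∪ Y₀) ∧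
      Touch G Y₁ (M ∪ Y₀) ∧ Touch G Y₂ (M ∪ Y₀) ∧
      ∀ E ⊆ D, Disjoint M E → Disjoint (M ∪ Y₀) E ∧ Disjoint Y₁ E ∧ Disjoint Y₂ E := by
  refine ⟨hM.union_of_mem h.model.conn₁ hv h.mem, h.model.disj₂₃,
    Set.disjoint_union_right.2 ⟨h.disj₁.mono_right hMD, h.model.disj₁₂.symm⟩,
    Set.disjoint_union_right.2 ⟨h.disj₂.mono_right hMD, h.model.disj₁₃.symm⟩,
    h.model.touch₁₂.symm.mono subset_rfl Set.subset_union_right,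
    h.model.touch₁₃.symm.mono subset_rfl Set.subset_union_right, fun E hE hME =>
    ⟨Set.disjoint_union_left.2 ⟨hME, Set.disjoint_left.2 fun x hx hxE => ?_⟩,
      h.disj₁.mono_right hE, h.disj₂.mono_right hE⟩⟩
  have : x = v := h.inter₀ ⟨hx, hE hxE⟩
  exact Set.disjoint_left.1 hME hv (this ▸ hxE)

theorem IsPendant.isMinorOf_O7 (h : IsPendant G v D Y₀ Y₁ Y₂) {M E F S T : Set V}
    (hv : v ∈ M) (hc : ∀ A ∈ [M, E, F, S, T], ConnSet G A)
    (hD : ∀ A ∈ [M, E, F, S, T], A ⊆ D) (hd : [M, E, F, S, T].Pairwise Disjoint)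
    (hME : Touch G M E) (hMF : Touch G M F) (hST : Touch G S T) (hES : Touch G E S)
    (hET : Touch G E T) (hFS : Touch G F S) (hFT : Touch G F T) : IsMinorOf O7 G := by
  simp only [List.forall_mem_cons, List.not_mem_nil, List.pairwise_cons, and_true,
    false_imp_iff, implies_true,
    List.Pairwise.nil] at hc hD hd
  have f := h.facts hc.1 hv hD.1
  have fE := f.2.2.2.2.2.2 E hD.2.1 hd.1.1
  have fF := f.2.2.2.2.2.2 F hD.2.2.1 hd.1.2.1
  have fS := f.2.2.2.2.2.2 S hD.2.2.2.1 hd.1.2.2.1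
  have fT := f.2.2.2.2.2.2 T hD.2.2.2.2 hd.1.2.2.2
  have hME' : Touch G (M ∪ Y₀) E := hME.mono Set.subset_union_left subset_rfl
  have hMF' : Touch G (M ∪ Y₀) F := hMF.mono Set.subset_union_left subset_rfl
  refine isMinorOf_mkGraph [Y₁, Y₂, S, T, E, F, M ∪ Y₀] _ ?_ ?_ ?_
  · simp only [List.forall_mem_cons, List.not_mem_nil, false_imp_iff, implies_true, and_true]
    exact ⟨h.model.conn₂, h.model.conn₃, hc.2.2.2.1, hc.2.2.2.2, hc.2.1, hc.2.2.1, f.1⟩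
  · simp only [List.forall_mem_cons, List.not_mem_nil, List.pairwise_cons, and_true,
    false_imp_iff, implies_true,
      List.Pairwise.nil]
    simp only [hd, f, fE, fF, fS, fT, fE.1.symm, fF.1.symm, fS.1.symm, fT.1.symm,
      hd.2.1.2.1.symm, hd.2.1.2.2.symm, hd.2.2.1.1.symm, hd.2.2.1.2.symm, and_self]
  · simp only [List.forall_mem_cons, List.not_mem_nil, false_imp_iff, implies_true, and_true]
    exact ⟨h.model.touch₂₃, f.2.2.2.2.1, f.2.2.2.2.2.1, hST, hES.symm, hFS.symm, hET.symm,
      hFT.symm, hME'.symm, hMF'.symm⟩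

theorem IsPendant.isMinorOf_O8 (h : IsPendant G v D Y₀ Y₁ Y₂) {M A E F B : Set V}
    (hv : v ∈ M) (hc : ∀ X ∈ [M, A, E, F, B], ConnSet G X)
    (hD : ∀ X ∈ [M, A, E, F, B], X ⊆ D) (hd : [M, A, E, F, B].Pairwise Disjoint)
    (hMA : Touch G M A) (hME : Touch G M E) (hMF : Touch G M F) (hAE : Touch G A E)
    (hAF : Touch G A F) (hEF : Touch G E F) (hBE : Touch G B E) (hBF : Touch G B F) :
    IsMinorOf O8 G := by
  simp only [List.forall_mem_cons, List.not_mem_nil, List.pairwise_cons, and_true,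
    false_imp_iff, implies_true,
    List.Pairwise.nil] at hc hD hd
  have f := h.facts hc.1 hv hD.1
  have fA := f.2.2.2.2.2.2 A hD.2.1 hd.1.1
  have fE := f.2.2.2.2.2.2 E hD.2.2.1 hd.1.2.1
  have fF := f.2.2.2.2.2.2 F hD.2.2.2.1 hd.1.2.2.1
  have fB := f.2.2.2.2.2.2 B hD.2.2.2.2 hd.1.2.2.2
  have hMA' : Touch G (M ∪ Y₀) A := hMA.mono Set.subset_union_left subset_rfl
  have hME' : Touch G (M ∪ Y₀) E := hME.mono Set.subset_union_left subset_rfl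
  have hMF' : Touch G (M ∪ Y₀) F := hMF.mono Set.subset_union_left subset_rfl
  refine isMinorOf_mkGraph [Y₁, Y₂, M ∪ Y₀, A, E, F, B] _ ?_ ?_ ?_
  · simp only [List.forall_mem_cons, List.not_mem_nil, false_imp_iff, implies_true, and_true]
    exact ⟨h.model.conn₂, h.model.conn₃, f.1, hc.2⟩
  · simp only [List.forall_mem_cons, List.not_mem_nil, List.pairwise_cons, and_true,
    false_imp_iff, implies_true,
      List.Pairwise.nil]
    simp only [hd, f, fA, fE, fF, fB, and_self]
  · simp only [List.forall_mem_cons, List.not_mem_nil, false_imp_iff, implies_true, and_true]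
    exact ⟨h.model.touch₂₃, f.2.2.2.2.1, f.2.2.2.2.2.1, hMA', hME', hMF', hAE, hAF, hEF,
      hBE.symm, hBF.symm⟩

theorem IsPendant.isMinorOf_O4 (h : IsPendant G v D Y₀ Y₁ Y₂) {M S T F A B : Set V}
    (hv : v ∈ M) (hc : ∀ X ∈ [M, S, T, F, A, B], ConnSet G X)
    (hD : ∀ X ∈ [M, S, T, F, A, B], X ⊆ D) (hd : [M, S, T, F, A, B].Pairwise Disjoint)
    (hMS : Touch G M S) (hMT : Touch G M T) (hST : Touch G S T) (hSF : Touch G S F)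
    (hTF : Touch G T F) (hFA : Touch G F A) (hFB : Touch G F B) (hAB : Touch G A B) :
    IsMinorOf O4 G := by
  simp only [List.forall_mem_cons, List.not_mem_nil, List.pairwise_cons, and_true,
    false_imp_iff, implies_true,
    List.Pairwise.nil] at hc hD hd
  have f := h.facts hc.1 hv hD.1
  have fS := f.2.2.2.2.2.2 S hD.2.1 hd.1.1
  have fT := f.2.2.2.2.2.2 T hD.2.2.1 hd.1.2.1
  have fF := f.2.2.2.2.2.2 F hD.2.2.2.1 hd.1.2.2.1
  have fA := f.2.2.2.2.2.2 A hD.2.2.2.2.1 hd.1.2.2.2.1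
  have fB := f.2.2.2.2.2.2 B hD.2.2.2.2.2 hd.1.2.2.2.2
  have hMS' : Touch G (M ∪ Y₀) S := hMS.mono Set.subset_union_left subset_rfl
  have hMT' : Touch G (M ∪ Y₀) T := hMT.mono Set.subset_union_left subset_rfl
  refine isMinorOf_mkGraph [Y₁, Y₂, M ∪ Y₀, S, T, F, A, B] _ ?_ ?_ ?_
  · simp only [List.forall_mem_cons, List.not_mem_nil, false_imp_iff, implies_true, and_true]
    exact ⟨h.model.conn₂, h.model.conn₃, f.1, hc.2⟩
  · simp only [List.forall_mem_cons, List.not_mem_nil, List.pairwise_cons, and_true,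
    false_imp_iff, implies_true,
      List.Pairwise.nil]
    simp only [hd, f, fS, fT, fA, fF, fB, and_self]
  · simp only [List.forall_mem_cons, List.not_mem_nil, false_imp_iff, implies_true, and_true]
    exact ⟨h.model.touch₂₃, f.2.2.2.2.1, f.2.2.2.2.2.1, hMS', hMT', hST, hSF, hTF, hFA,
      hFB, hAB⟩

end Patterns

section DiamondButterfly

variable {V : Type} {G : SimpleGraph V}

/-- `T` contains a model of the diamond. -/
def HasDiamond (G : SimpleGraph V) (T : Set V) : Prop :=
  ∃ A B C D, (∀ X ∈ [A, B, C, D], ConnSet G X) ∧ (∀ X ∈ [A, B, C, D], X ⊆ T) ∧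
    [A, B, C, D].Pairwise Disjoint ∧ Touch G A B ∧ Touch G A C ∧ Touch G A D ∧
    Touch G B C ∧ Touch G B D

/-- `T` contains a model of the butterfly. -/
def HasButterfly (G : SimpleGraph V) (T : Set V) : Prop :=
  ∃ A B C D E, (∀ X ∈ [A, B, C, D, E], ConnSet G X) ∧ (∀ X ∈ [A, B, C, D, E], X ⊆ T) ∧
    [A, B, C, D, E].Pairwise Disjoint ∧ Touch G A B ∧ Touch G A C ∧ Touch G B C ∧
    Touch G A D ∧ Touch G A E ∧ Touch G D E

theorem pairwise_disjoint_append {l l' : List (Set V)} {T T' : Set V} (hd : Disjoint T T')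
    (hl : l.Pairwise Disjoint) (hl' : l'.Pairwise Disjoint) (h : ∀ X ∈ l, X ⊆ T)
    (h' : ∀ X ∈ l', X ⊆ T') : (l ++ l').Pairwise Disjoint :=
  List.pairwise_append.2 ⟨hl, hl', fun X hX Y hY => hd.mono (h X hX) (h' Y hY)⟩

theorem HasDiamond.isMinorOf_O1 {T T' : Set V} (h : HasDiamond G T) (h' : HasDiamond G T')
    (hd : Disjoint T T') : IsMinorOf O1 G := by
  obtain ⟨A, B, C, D, hc, hs, hp, t1, t2, t3, t4, t5⟩ := h
  obtain ⟨A', B', C', D', hc', hs', hp', t1', t2', t3', t4', t5'⟩ := h'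
  refine isMinorOf_mkGraph ([A, B, C, D] ++ [A', B', C', D']) _
    (fun X hX => (List.mem_append.1 hX).elim (hc X) (hc' X))
    (pairwise_disjoint_append hd hp hp' hs hs') ?_
  simp only [List.forall_mem_cons, List.not_mem_nil, false_imp_iff, implies_true, and_true]
  exact ⟨t1, t2, t3, t4, t5, t1', t2', t3', t4', t5'⟩

theorem HasButterfly.isMinorOf_O2 {T T' : Set V} (h : HasButterfly G T) (h' : HasButterfly G T')
    (hd : Disjoint T T') : IsMinorOf O2 G := by
  obtain ⟨A, B, C, D, E, hc, hs, hp, t1, t2, t3, t4, t5, t6⟩ := h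
  obtain ⟨A', B', C', D', E', hc', hs', hp', t1', t2', t3', t4', t5', t6'⟩ := h'
  refine isMinorOf_mkGraph ([A, B, C, D, E] ++ [A', B', C', D', E']) _
    (fun X hX => (List.mem_append.1 hX).elim (hc X) (hc' X))
    (pairwise_disjoint_append hd hp hp' hs hs') ?_
  simp only [List.forall_mem_cons, List.not_mem_nil, false_imp_iff, implies_true, and_true]
  exact ⟨t1, t2, t3, t4, t5, t6, t1', t2', t3', t4', t5', t6'⟩

theorem HasDiamond.isMinorOf_O3 {T T' : Set V} (h : HasDiamond G T) (h' : HasButterfly G T')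
    (hd : Disjoint T T') : IsMinorOf O3 G := by
  obtain ⟨A, B, C, D, hc, hs, hp, t1, t2, t3, t4, t5⟩ := h
  obtain ⟨A', B', C', D', E', hc', hs', hp', t1', t2', t3', t4', t5', t6'⟩ := h'
  refine isMinorOf_mkGraph ([A, B, C, D] ++ [A', B', C', D', E']) _
    (fun X hX => (List.mem_append.1 hX).elim (hc X) (hc' X))
    (pairwise_disjoint_append hd hp hp' hs hs') ?_
  simp only [List.forall_mem_cons, List.not_mem_nil, false_imp_iff, implies_true, and_true]
  exact ⟨t1, t2, t3, t4, t5, t1', t2', t3', t4', t5', t6'⟩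

theorem TriangleModel.hasDiamond_or_hasButterfly_of_touch {A B C Y Z T : Set V}
    (h : TriangleModel G A B C) (hY : ConnSet G Y) (hZ : ConnSet G Z) (hYZ : Touch G Y Z)
    (hd : Disjoint Y Z) (hdY : Disjoint (A ∪ B ∪ C) Y) (hdZ : Disjoint (A ∪ B ∪ C) Z)
    (hT : A ∪ B ∪ C ⊆ T) (hYT : Y ⊆ T) (hZT : Z ⊆ T) (hAY : Touch G A Y)
    (hAZ : Touch G A Z ∨ Touch G B Z ∨ Touch G C Z) : HasDiamond G T ∨ HasButterfly G T := by
  obtain ⟨hA, hB, hC, hAB, hAC, hBC, tAB, tAC, tBC⟩ := h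
  have hU := hY.union hZ hYZ
  simp only [Set.disjoint_union_left, Set.union_subset_iff] at hdY hdZ hT
  have tAY : Touch G A (Y ∪ Z) := hAY.mono subset_rfl Set.subset_union_left
  rcases hAZ with h | h | h
  · right
    refine ⟨A, B, C, Y, Z, ?_, ?_, ?_, tAB, tAC, tBC, hAY, h, hYZ⟩
    · simp [*]
    · simp [*]
    · simp [*]
  · left
    refine ⟨A, B, C, Y ∪ Z, ?_, ?_, ?_, tAB, tAC, tAY, tBC,
      h.mono subset_rfl Set.subset_union_right⟩
    · simp [*]
    · simp [*]
    · simp [*]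
  · left
    refine ⟨A, C, B, Y ∪ Z, ?_, ?_, ?_, tAC, tAB, tAY, tBC.symm,
      h.mono subset_rfl Set.subset_union_right⟩
    · simp [*]
    · simp [*]
    · simp [*, hBC.symm]

theorem TriangleModel.hasDiamond_or_hasButterfly [Finite V] {X Y Z T : Set V}
    (h : TriangleModel G X Y Z) (hX : ¬ (G.induce X).IsAcyclic) (hT : X ∪ Y ∪ Z ⊆ T) :
    HasDiamond G T ∨ HasButterfly G T := by
  obtain ⟨A, B, C, hABC, rfl⟩ := h.conn₁.exists_triangleModel hX
  simp only [Set.union_subset_iff] at hT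
  have tZ : Touch G A Z ∨ Touch G B Z ∨ Touch G C Z := by
    rcases h.touch₁₃.union_left with h | h
    · rcases h.union_left with h | h
      · exact Or.inl h
      · exact Or.inr (Or.inl h)
    · exact Or.inr (Or.inr h)
  rcases h.touch₁₂.union_left with h1 | h1
  · rcases h1.union_left with h1 | h1
    · exact hABC.hasDiamond_or_hasButterfly_of_touch h.conn₂ h.conn₃ h.touch₂₃ h.disj₂₃ h.disj₁₂
        h.disj₁₃ (by simp [hT]) hT.1.2 hT.2 h1 tZ
    · have e : A ∪ B ∪ C = B ∪ C ∪ A := by ext; simp; tauto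
      exact hABC.rotate.hasDiamond_or_hasButterfly_of_touch h.conn₂ h.conn₃ h.touch₂₃ h.disj₂₃
        (e ▸ h.disj₁₂) (e ▸ h.disj₁₃) (by simp [hT]) hT.1.2 hT.2 h1 (by tauto)
  · have e : A ∪ B ∪ C = C ∪ A ∪ B := by ext; simp; tauto
    exact hABC.rotate.rotate.hasDiamond_or_hasButterfly_of_touch h.conn₂ h.conn₃ h.touch₂₃
      h.disj₂₃ (e ▸ h.disj₁₂) (e ▸ h.disj₁₃) (by simp [hT]) hT.1.2 hT.2 h1 (by tauto)

theorem TriangleModel.hasDiamond [Finite V] {X Y Z T : Set V}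
    (h : TriangleModel G X Y Z) (hX : DoubleTouch G X Y) (hT : X ∪ Y ∪ Z ⊆ T) :
    HasDiamond G T := by
  obtain ⟨P, Q, hP, hQ, hd, rfl, hPQ, tP, tQ⟩ := hX.exists_split h.conn₁
  have hd' := h.disj₁₂
  have hd'' := h.disj₁₃
  have hd3 := h.disj₂₃
  have h2 := h.conn₂
  have h3 := h.conn₃
  simp only [Set.disjoint_union_left, Set.union_subset_iff] at hd' hd'' hT
  rcases h.touch₁₃.union_left with hZ | hZ
  · refine ⟨P, Y, Q, Z, ?_, ?_, ?_, tP, hPQ, hZ, tQ.symm, h.touch₂₃⟩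
    · simp [*]
    · simp [*]
    · simp [*, hd'.2.symm]
  · refine ⟨Q, Y, P, Z, ?_, ?_, ?_, tQ, hPQ.symm, hZ, tP.symm, h.touch₂₃⟩
    · simp [*]
    · simp [*]
    · simp [*, hd'.1.symm, hd.symm]

/-- A connected set that does not induce a pseudoforest contains a diamond or a butterfly. -/
theorem ConnSet.hasDiamond_or_hasButterfly [Finite V] {T : Set V} (hT : ConnSet G T)
    (h : ¬ Pseudoforest (G.induce T)) : HasDiamond G T ∨ HasButterfly G T := by
  obtain ⟨X, Y, Z, hm, rfl⟩ := hT.exists_triangleModel (not_isAcyclic_of_not_pseudoforest h)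
  rcases exists_not_isAcyclic_or_doubleTouch hm.disj₁₂ hm.disj₁₃ hm.disj₂₃ h with
    (h | h | h) | h | h | h | h | h | h
  · exact hm.hasDiamond_or_hasButterfly h subset_rfl
  · exact hm.rotate.hasDiamond_or_hasButterfly h (by intro x; simp; tauto)
  · exact hm.rotate.rotate.hasDiamond_or_hasButterfly h (by intro x; simp; tauto)
  · exact Or.inl (hm.hasDiamond h subset_rfl)
  · exact Or.inl (hm.swap.hasDiamond h (by intro x; simp; tauto))
  · exact Or.inl (hm.rotate.hasDiamond h (by intro x; simp; tauto))
  · exact Or.inl (hm.rotate.swap.hasDiamond h (by intro x; simp; tauto))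
  · exact Or.inl (hm.rotate.rotate.hasDiamond h (by intro x; simp; tauto))
  · exact Or.inl (hm.rotate.rotate.swap.hasDiamond h (by intro x; simp; tauto))

theorem ExcludesMinors.not_disjoint [Finite V] (hG : ExcludesMinors G) {S T : Set V}
    (hS : HasDiamond G S ∨ HasButterfly G S) (hT : HasDiamond G T ∨ HasButterfly G T) :
    ¬ Disjoint S T := by
  intro hd
  rcases hS with hS | hS <;> rcases hT with hT | hT
  · exact hG.o1 (hS.isMinorOf_O1 hT hd)
  · exact hG.o3 (hS.isMinorOf_O3 hT hd)
  · exact hG.o3 (hT.isMinorOf_O3 hS hd.symm)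
  · exact hG.o2 (hS.isMinorOf_O2 hT hd)

/-- Proper induced subgraphs of an obstruction are apex-pseudoforests. -/
theorem ObsApexPseudoforest.exists_of_ne_univ [Finite V] (h : ObsApexPseudoforest G) {S : Set V}
    (hS : S ≠ Set.univ) :
    ∃ s : Set V, s ⊆ S ∧ s.Subsingleton ∧ Pseudoforest (G.induce (S \ s)) := by
  have hm : IsMinorOf (G.induce S) G := by
    refine ⟨fun x => {(x : V)}, fun x => connected_induce_iff_connSet.2 (connSet_singleton _), ?_,
      ?_⟩
    · intro x y hxy
      simpa [Subtype.ext_iff] using hxy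
    · intro x y hxy
      exact ⟨x, rfl, y, rfl, hxy⟩
  have hne : IsEmpty (G.induce S ≃g G) := by
    refine ⟨fun e => hS ?_⟩
    have : S.ncard = Nat.card V := Nat.card_congr e.toEquiv
    exact (Set.eq_univ_iff_ncard S).2 this
  obtain ⟨s, hs, hpf⟩ := h.2 S (G.induce S) hm hne
  refine ⟨(↑) '' s, by simp, hs.image _, ?_⟩
  let f : G.induce (S \ (↑) '' s) ↪g (G.induce S).induce sᶜ :=
    { toFun := fun x => ⟨⟨x.1, x.2.1⟩, fun hx => x.2.2 ⟨_, hx, rfl⟩⟩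
      inj' := by
        intro x y hxy
        simpa [Subtype.ext_iff] using hxy
      map_rel_iff' := by
        intros
        exact Iff.rfl }
  exact hpf.of_embedding f

theorem ObsApexPseudoforest.not_pseudoforest_compl (h : ObsApexPseudoforest G) {s : Set V}
    (hs : s.Subsingleton) : ¬ Pseudoforest (G.induce sᶜ) := fun hpf => h.1 ⟨s, hs, hpf⟩

/-- Obstructions other than the disconnected ones are connected. -/
theorem ObsApexPseudoforest.connSet_univ [Finite V] (h : ObsApexPseudoforest G)
    (hG : ExcludesMinors G) : ConnSet G Set.univ := by
  have h0 := h.not_pseudoforest_compl Set.subsingleton_empty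
  obtain ⟨T, -, hT, hcl, hTn⟩ := exists_connSet_not_pseudoforest h0
  by_cases hu : T = Set.univ
  · exact hu ▸ hT
  exfalso
  obtain ⟨s, hsT, hs, hpf⟩ := h.exists_of_ne_univ hu
  obtain ⟨T', hT's, hT', -, hTn'⟩ := exists_connSet_not_pseudoforest (h.not_pseudoforest_compl hs)
  refine hG.not_disjoint (hT.hasDiamond_or_hasButterfly hTn) (hT'.hasDiamond_or_hasButterfly hTn')
    (Set.disjoint_left.2 fun x hx hx' => hTn' (hpf.induce_mono (Set.subset_inter ?_ hT's)))
  exact hT'.2 T ⟨x, hx', hx⟩ fun a _ haT b _ hab => hcl a haT b (by simp) hab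

end DiamondButterfly

section Menger

variable {V : Type} {G : SimpleGraph V}

/-- `C` is a connected subset of `S` that meets both `A` and `B`. -/
structure IsLink (G : SimpleGraph V) (S A B C : Set V) : Prop where
  sub : C ⊆ S
  conn : ConnSet G C
  left : ∃ x ∈ C, x ∈ A
  right : ∃ x ∈ C, x ∈ B

theorem ConnSet.of_adj {G' : SimpleGraph V} {C : Set V} (h : ConnSet G C)
    (hle : ∀ x ∈ C, ∀ y ∈ C, G.Adj x y → G'.Adj x y) : ConnSet G' C :=
  ⟨h.1, fun U hU hcl => h.2 U hU fun a ha haU b hb hab => hcl a ha haU b hb (hle a ha b hb hab)⟩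

theorem IsLink.mono {G' : SimpleGraph V} {S A B C : Set V} (h : IsLink G S A B C) (hle : G ≤ G') :
    IsLink G' S A B C :=
  ⟨h.sub, h.conn.of_adj fun _ _ _ _ hab => hle hab, h.left, h.right⟩

theorem IsLink.symm {S A B C : Set V} (h : IsLink G S A B C) : IsLink G S B A C :=
  ⟨h.sub, h.conn, h.right, h.left⟩

/-- The part of `S` that is reachable from `A` while avoiding `s`. -/
def reach (G : SimpleGraph V) (S A : Set V) (s : V) : Set V :=
  {z | ∃ C, s ∉ C ∧ IsLink G S A {z} C}

theorem mem_reach_of_mem {S A : Set V} {s z : V} (hz : z ∈ S) (hA : z ∈ A) (hs : z ≠ s) :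
    z ∈ reach G S A s :=
  ⟨{z}, fun h => hs (Set.mem_singleton_iff.1 h).symm, by simpa using hz, connSet_singleton z,
    ⟨z, rfl, hA⟩, ⟨z, rfl, rfl⟩⟩

theorem mem_reach_of_adj {S A : Set V} {s z w : V} (hz : z ∈ reach G S A s) (hw : w ∈ S)
    (hs : w ≠ s) (h : G.Adj z w) : w ∈ reach G S A s := by
  obtain ⟨C, hsC, hC⟩ := hz
  obtain ⟨z', hz', rfl⟩ := hC.right
  obtain ⟨x, hx, hxA⟩ := hC.left
  exact ⟨C ∪ {w}, by simp [hsC, hs.symm], by simpa [Set.insert_subset_iff, hw] using hC.sub,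
    hC.conn.union (connSet_singleton w) ⟨_, hz', w, rfl, h⟩, ⟨x, Or.inl hx, hxA⟩,
    ⟨w, Or.inr rfl, rfl⟩⟩

theorem IsLink.subset_reach {S A B C : Set V} {s : V} (h : IsLink G S A B C) (hs : s ∉ C) :
    C ⊆ reach G S A s := fun x hx => ⟨C, hs, h.sub, h.conn, h.left, ⟨x, hx, rfl⟩⟩

theorem exists_isLink_of_mem_reach {S A B : Set V} {s z : V} (hA : z ∈ reach G S A s)
    (hB : z ∈ reach G S B s) : ∃ C, s ∉ C ∧ IsLink G S A B C := by
  obtain ⟨C, hsC, hC⟩ := hA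
  obtain ⟨D, hsD, hD⟩ := hB
  obtain ⟨z', hz', rfl⟩ := hC.right
  obtain ⟨z', hz'', rfl⟩ := hD.right
  obtain ⟨x, hx, hxA⟩ := hC.left
  obtain ⟨y, hy, hyB⟩ := hD.left
  exact ⟨C ∪ D, by simp [hsC, hsD], Set.union_subset hC.sub hD.sub,
    hC.conn.union_of_mem hD.conn hz' hz'', ⟨x, Or.inl hx, hxA⟩, ⟨y, Or.inr hy, hyB⟩⟩

theorem exists_links_to_separator {G' : SimpleGraph V} {S A B : Set V} {a b s : V}
    (hle : ∀ x y, G.Adj x y → G'.Adj x y ∨ (x = a ∧ y = b) ∨ (x = b ∧ y = a))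
    (ih : ∀ A B : Set V, (∀ u, ∃ C, u ∉ C ∧ IsLink G' S A B C) →
      ∃ P Q, Disjoint P Q ∧ IsLink G' S A B P ∧ IsLink G' S A B Q)
    (h : ∀ u, ∃ C, u ∉ C ∧ IsLink G S A B C) (hs : ∀ C, IsLink G' S A B C → s ∈ C)
    (hb : b ∉ reach G' S A s) :
    ∃ P Q, Disjoint P Q ∧ IsLink G' S A {a} P ∧ IsLink G' S A {s} Q ∧ s ∉ P ∧
      P ⊆ reach G' S A s ∧ Q ⊆ insert s (reach G' S A s) := by
  have key : ∃ P Q, Disjoint P Q ∧ IsLink G' S A {s, a} P ∧ IsLink G' S A {s, a} Q := by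
    refine ih _ _ fun u => ?_
    obtain ⟨C, huC, hC⟩ := h u
    obtain ⟨c, hc, hcA⟩ := hC.left
    obtain ⟨K, hKC, hcK, hK, hcl⟩ := exists_component (G := G') hc
    refine ⟨K, fun hu => huC (hKC hu), hKC.trans hC.sub, hK, ⟨c, hcK, hcA⟩, ?_⟩
    by_contra hno
    have hsK : s ∉ K := fun hh => hno ⟨s, hh, Or.inl rfl⟩
    have haK : a ∉ K := fun hh => hno ⟨a, hh, Or.inr rfl⟩
    have hCK : C ⊆ K := hC.conn.2 K ⟨c, hc, hcK⟩ fun x hx hxK y hy hxy => by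
      rcases hle x y hxy with h' | ⟨rfl, rfl⟩ | ⟨rfl, rfl⟩
      · exact hcl x hxK y hy h'
      · exact absurd hxK haK
      · exact absurd ⟨K, hsK, hKC.trans hC.sub, hK, ⟨c, hcK, hcA⟩, ⟨x, hxK, rfl⟩⟩ hb
    obtain ⟨d, hd, hdB⟩ := hC.right
    exact hsK (hs K ⟨hKC.trans hC.sub, hK, ⟨c, hcK, hcA⟩, ⟨d, hCK hd, hdB⟩⟩)
  have key' : ∃ P Q, Disjoint P Q ∧ IsLink G' S A {a} P ∧ IsLink G' S A {s} Q := by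
    obtain ⟨P, Q, hd, hP, hQ⟩ := key
    obtain ⟨p, hp, rfl | rfl⟩ := hP.right <;> obtain ⟨q, hq, rfl | rfl⟩ := hQ.right
    · exact absurd hq (Set.disjoint_left.1 hd hp)
    · exact ⟨Q, P, hd.symm, ⟨hQ.sub, hQ.conn, hQ.left, _, hq, rfl⟩,
        ⟨hP.sub, hP.conn, hP.left, _, hp, rfl⟩⟩
    · exact ⟨P, Q, hd, ⟨hP.sub, hP.conn, hP.left, _, hp, rfl⟩,
        ⟨hQ.sub, hQ.conn, hQ.left, _, hq, rfl⟩⟩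
    · exact absurd hq (Set.disjoint_left.1 hd hp)
  obtain ⟨P, Q, hd, hP, hQ⟩ := key'
  obtain ⟨s', hsQ, rfl⟩ := hQ.right
  have hsP : s' ∉ P := fun hh => Set.disjoint_left.1 hd hh hsQ
  refine ⟨P, Q ∩ insert s' (reach G' S A s'), hd.mono_right Set.inter_subset_left, hP,
    ⟨Set.inter_subset_left.trans hQ.sub, hQ.conn.inter_insert hsQ ?_, ?_,
      ⟨s', ⟨hsQ, Or.inl rfl⟩, rfl⟩⟩, hsP, hP.subset_reach hsP, Set.inter_subset_right⟩
  · exact fun x hx y hy hyn hys hxy => hyn (mem_reach_of_adj hx (hQ.sub hy) hys hxy)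
  · obtain ⟨c, hc, hcA⟩ := hQ.left
    refine ⟨c, ⟨hc, ?_⟩, hcA⟩
    by_cases hcs : c = s'
    · exact Or.inl hcs
    · exact Or.inr (mem_reach_of_mem (hQ.sub hc) hcA hcs)

/-- **Menger's theorem** for two disjoint connections between `A` and `B` inside `S`. -/
theorem exists_disjoint_links [Finite V] [Nonempty V] (S A B : Set V)
    (h : ∀ u, ∃ C, u ∉ C ∧ IsLink G S A B C) :
    ∃ P Q, Disjoint P Q ∧ IsLink G S A B P ∧ IsLink G S A B Q := by
  induction hn : G.edgeSet.ncard using Nat.strong_induction_on generalizing G A B with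
  | _ n ih =>
  by_cases hE : ∀ x y, ¬ G.Adj x y
  · have key : ∀ C, IsLink G S A B C → ∀ x ∈ C, x ∈ A ∧ x ∈ B := by
      intro C hC x hx
      have hCx : C ⊆ {x} := hC.conn.2 {x} ⟨x, hx, rfl⟩ fun a _ _ b _ hab => absurd hab (hE a b)
      obtain ⟨y, hy, hyA⟩ := hC.left
      obtain ⟨z, hz, hzB⟩ := hC.right
      exact ⟨hCx hy ▸ hyA, hCx hz ▸ hzB⟩
    have single : ∀ C, IsLink G S A B C → ∀ x ∈ C, IsLink G S A B {x} := fun C hC x hx =>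
      ⟨by simpa using hC.sub hx, connSet_singleton x, ⟨x, rfl, (key C hC x hx).1⟩,
        ⟨x, rfl, (key C hC x hx).2⟩⟩
    obtain ⟨C, -, hC⟩ := h (Classical.arbitrary V)
    obtain ⟨x, hx⟩ := hC.conn.1
    obtain ⟨D, hxD, hD⟩ := h x
    obtain ⟨y, hy⟩ := hD.conn.1
    exact ⟨{x}, {y}, by
      rw [Set.disjoint_singleton]
      rintro rfl
      exact hxD hy, single C hC x hx, single D hD y hy⟩
  · push Not at hE
    obtain ⟨x, y, hxy⟩ := hE
    have hlt : (G.deleteEdges {s(x, y)}).edgeSet.ncard < n := by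
      rw [← hn, edgeSet_deleteEdges]
      exact Set.ncard_sdiff_singleton_lt_of_mem hxy
    have ih' := fun A B hAB => ih _ hlt (G := G.deleteEdges {s(x, y)}) A B hAB rfl
    have hG' : G.deleteEdges {s(x, y)} ≤ G := deleteEdges_le _
    have hle : ∀ x' y', G.Adj x' y' → (G.deleteEdges {s(x, y)}).Adj x' y' ∨
        (x' = x ∧ y' = y) ∨ (x' = y ∧ y' = x) := by
      intro x' y' h'
      rw [deleteEdges_adj]
      by_cases he : s(x', y') ∈ ({s(x, y)} : Set (Sym2 V))
      · right
        simpa using he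
      · exact Or.inl ⟨h', he⟩
    generalize G.deleteEdges {s(x, y)} = G' at *
    by_cases hs : ∀ u, ∃ C, u ∉ C ∧ IsLink G' S A B C
    · obtain ⟨P, Q, hd, hP, hQ⟩ := ih' A B hs
      exact ⟨P, Q, hd, hP.mono hG', hQ.mono hG'⟩
    push Not at hs
    obtain ⟨s, hs⟩ := hs
    have hs' : ∀ C, IsLink G' S A B C → s ∈ C := fun C hC => by_contra fun hh => hs C hh hC
    have hdis : ∀ z, z ∈ reach G' S A s → z ∉ reach G' S B s := fun z hA hB => by
      obtain ⟨C, hsC, hC⟩ := exists_isLink_of_mem_reach hA hB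
      exact hs C hsC hC
    obtain ⟨C, hsC, hC⟩ := h s
    obtain ⟨c, hc, hcA⟩ := hC.left
    obtain ⟨d, hd, hdB⟩ := hC.right
    have hne : ∀ z ∈ C, z ≠ s := fun z hz e => hsC (e ▸ hz)
    have hcR := mem_reach_of_mem (G := G') (hC.sub hc) hcA (hne c hc)
    have hdR := mem_reach_of_mem (G := G') (hC.sub hd) hdB (hne d hd)
    obtain ⟨a, haC, haR, b, hbC, hbR, hab⟩ := hC.conn.cross (U := reach G' S A s)
      ⟨c, hc, hcR⟩ ⟨d, hd, fun hh => hdis d hh hdR⟩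
    obtain ⟨a', haC', haR', b', hbC', hbR', hab'⟩ := hC.conn.cross (U := reach G' S B s)
      ⟨d, hd, hdR⟩ ⟨c, hc, hdis c hcR⟩
    have e1 := (hle a b hab).resolve_left fun hh =>
      hbR (mem_reach_of_adj haR (hC.sub hbC) (hne b hbC) hh)
    have e2 := (hle a' b' hab').resolve_left fun hh =>
      hbR' (mem_reach_of_adj haR' (hC.sub hbC') (hne b' hbC') hh)
    have hbB : b ∈ reach G' S B s := by
      have : a' ≠ a := fun e => hdis a haR (e ▸ haR')
      have : a' = b := by
        rcases e1 with ⟨rfl, rfl⟩ | ⟨rfl, rfl⟩ <;> rcases e2 with ⟨rfl, rfl⟩ | ⟨rfl, rfl⟩ <;>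
          first | rfl | exact absurd rfl this
      exact this ▸ haR'
    have hle' : ∀ x' y', G.Adj x' y' → G'.Adj x' y' ∨ (x' = a ∧ y' = b) ∨ (x' = b ∧ y' = a) := by
      rcases e1 with ⟨rfl, rfl⟩ | ⟨rfl, rfl⟩
      · exact hle
      · exact fun x' y' h' => (hle x' y' h').imp_right Or.symm
    obtain ⟨P, Q, hPQ, hP, hQ, hsP, hPR, hQR⟩ := exists_links_to_separator hle' ih' h hs' hbR
    obtain ⟨P', Q', hPQ', hP', hQ', hsP', hPR', hQR'⟩ :=
      exists_links_to_separator (fun x' y' h' => (hle' x' y' h').imp_right Or.symm) ih'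
        (fun u => (h u).imp fun C hC => ⟨hC.1, hC.2.symm⟩) (fun C hC => hs' C hC.symm) (hdis a haR)
    obtain ⟨_, haP, rfl⟩ := hP.right
    obtain ⟨_, hsQ, rfl⟩ := hQ.right
    obtain ⟨_, hbP, rfl⟩ := hP'.right
    obtain ⟨_, hsQ', rfl⟩ := hQ'.right
    refine ⟨P ∪ P', Q ∪ Q', ?_, ⟨Set.union_subset hP.sub hP'.sub, ?_, ?_, ?_⟩,
      ⟨Set.union_subset hQ.sub hQ'.sub, ?_, ?_, ?_⟩⟩
    · simp only [Set.disjoint_union_left, Set.disjoint_union_right]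
      refine ⟨⟨hPQ, ?_⟩, ?_, hPQ'⟩
      · refine Set.disjoint_left.2 fun z hz hz' => ?_
        rcases hQR hz' with rfl | hh
        · exact hsP' hz
        · exact hdis z hh (hPR' hz)
      · refine Set.disjoint_left.2 fun z hz hz' => ?_
        rcases hQR' hz' with rfl | hh
        · exact hsP hz
        · exact hdis z (hPR hz) hh
    · exact (hP.mono hG').conn.union (hP'.mono hG').conn ⟨_, haP, _, hbP, hab⟩
    · exact hP.left.imp fun _ hx => ⟨Or.inl hx.1, hx.2⟩
    · exact hP'.left.imp fun _ hx => ⟨Or.inr hx.1, hx.2⟩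
    · exact (hQ.mono hG').conn.union_of_mem (hQ'.mono hG').conn hsQ hsQ'
    · exact hQ.left.imp fun _ hx => ⟨Or.inl hx.1, hx.2⟩
    · exact hQ'.left.imp fun _ hx => ⟨Or.inr hx.1, hx.2⟩

end Menger

section Biconnected

variable {V : Type} {G : SimpleGraph V}

theorem ConnSet.exists_isPath {T : Set V} (hT : ConnSet G T) {u w : V} (hu : u ∈ T) (hw : w ∈ T) :
    ∃ p : G.Walk u w, p.IsPath ∧ ∀ x ∈ p.support, x ∈ T := by
  obtain ⟨p, hp⟩ := ((connected_induce_iff_connSet.2 hT).preconnected ⟨u, hu⟩ ⟨w, hw⟩).exists_isPath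
  refine ⟨p.map (Embedding.induce T).toHom, hp.map
    (f := (Embedding.induce T).toHom) (Embedding.induce (G := G) T).injective, ?_⟩
  intro x hx
  obtain ⟨y, -, rfl⟩ := List.mem_map.1 (p.support_map _ ▸ hx)
  exact y.2

theorem ConnSet.exists_link_neighbors {Y : Set V} (hY : ConnSet G Y) {u w : V} (hu : u ∈ Y)
    (hw : w ∈ Y) (huw : u ≠ w) (hadj : ¬ G.Adj u w) :
    ∃ C ⊆ Y, IsLink G {u, w}ᶜ {x | G.Adj u x} {x | G.Adj w x} C := by
  by_contra hno
  obtain ⟨a, haY, haU, b, hbY, hbU, hab⟩ := hY.cross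
    (U := {z | z = u ∨ ∃ C ⊆ Y, IsLink G {u, w}ᶜ {x | G.Adj u x} {z} C}) ⟨u, hu, Or.inl rfl⟩
    ⟨w, hw, by
      rintro (h | ⟨C, -, hC⟩)
      · exact huw h.symm
      · obtain ⟨_, hx, rfl⟩ := hC.right
        exact hC.sub hx (by simp)⟩
  have hbu : b ≠ u := fun e => hbU (Or.inl e)
  rcases haU with rfl | ⟨C, hCY, hC⟩
  · have hbw : b ≠ w := fun e => hadj (e ▸ hab)
    exact hbU (Or.inr ⟨{b}, by simpa using hbY, by simp [hbu, hbw], connSet_singleton b,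
      ⟨b, rfl, hab⟩, ⟨b, rfl, rfl⟩⟩)
  · obtain ⟨_, haC, rfl⟩ := hC.right
    obtain ⟨x, hx, hxu⟩ := hC.left
    by_cases hbw : b = w
    · subst hbw
      exact hno ⟨C, hCY, hC.sub, hC.conn, hC.left, ⟨_, haC, hab.symm⟩⟩
    · exact hbU (Or.inr ⟨C ∪ {b}, by simpa [Set.insert_subset_iff, hbY] using hCY,
        Set.union_subset hC.sub (by simp [hbu, hbw]),
        hC.conn.union (connSet_singleton b) ⟨_, haC, b, rfl, hab⟩, ⟨x, Or.inl hx, hxu⟩,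
        ⟨b, Or.inr rfl, rfl⟩⟩)

theorem exists_mem_support_of_not_adj {u w : V} (p : G.Walk u w) (huw : u ≠ w)
    (hadj : ¬ G.Adj u w) : ∃ x ∈ p.support, x ≠ u ∧ x ≠ w := by
  cases p with
  | nil => exact absurd rfl huw
  | cons h q =>
    refine ⟨_, List.mem_cons_of_mem _ q.start_mem_support, h.ne', ?_⟩
    rintro rfl
    exact hadj h

theorem exists_two_paths {u w : V} (P Q : G.Walk u w) (hP : P.IsPath) (hQ : Q.IsPath)
    (hne : P ≠ Q) (hd : ∀ x, x ∈ P.support → x ∈ Q.support → x = u ∨ x = w) :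
    ∃ P : Fin 2 → G.Walk u w, Function.Injective P ∧ (∀ i, (P i).IsPath) ∧
      ∀ i j, i ≠ j → ∀ x, x ∈ (P i).support → x ∈ (P j).support → x = u ∨ x = w := by
  refine ⟨![P, Q], ?_, ?_, ?_⟩
  · intro i j hij
    fin_cases i <;> fin_cases j <;> simp_all
  · intro i
    fin_cases i <;> assumption
  · intro i j hij
    fin_cases i <;> fin_cases j
    · exact absurd rfl hij
    · exact hd
    · exact fun x hx hx' => hd x hx' hx
    · exact absurd rfl hij

/-- A connected graph on at least three vertices without cut vertices is biconnected. -/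
theorem kConnected_two_of_connSet [Finite V] (hV : 2 < Nat.card V) (h0 : ConnSet G Set.univ)
    (h : ∀ v, ConnSet G {v}ᶜ) : KConnected 2 G := by
  intro u w huw
  have : Nonempty V := ⟨u⟩
  by_cases hadj : G.Adj u w
  · obtain ⟨z, hz⟩ : ∃ z, z ∉ ({u, w} : Set V) := by
      by_contra! hall
      have : ({u, w} : Set V) = Set.univ := Set.eq_univ_of_forall hall
      have h2 := Set.ncard_pair huw
      rw [this, Set.ncard_univ] at h2
      omega
    have hz' : z ≠ u ∧ z ≠ w := by simpa using hz
    have hdel : ∀ v, v = u ∨ v = w → ConnSet (G.deleteEdges {s(u, w)}) {v}ᶜ := fun v hv =>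
      (h v).of_adj fun x hx y hy hxy => by
        rw [deleteEdges_adj]
        refine ⟨hxy, fun he => ?_⟩
        have hx' : x ≠ v := hx
        have hy' : y ≠ v := hy
        have : (x = u ∧ y = w) ∨ (x = w ∧ y = u) := by simpa using he
        rcases hv with rfl | rfl <;> tauto
    obtain ⟨p, hp, -⟩ := ((hdel w (Or.inr rfl)).union_of_mem (hdel u (Or.inl rfl)) (v := z)
      hz'.2 hz'.1).exists_isPath (u := u) (w := w) (Or.inl huw) (Or.inr huw.symm)
    refine exists_two_paths hadj.toWalk (p.mapLe (deleteEdges_le _)) ?_ ?_ ?_ ?_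
    · simp [Walk.cons_isPath_iff, huw]
    · exact (Walk.isPath_mapLe _).2 hp
    · intro e
      have h1 : s(u, w) ∈ (hadj.toWalk).edges := by simp
      rw [e, Walk.edges_mapLe_eq_edges] at h1
      simpa [deleteEdges_adj] using p.adj_of_mem_edges h1
    · intro x hx _
      simpa using hx
  · obtain ⟨P, Q, hd, hP, hQ⟩ := exists_disjoint_links (G := G) {u, w}ᶜ {x | G.Adj u x}
      {x | G.Adj w x} fun t => by
        by_cases ht : t = u ∨ t = w
        · obtain ⟨C, -, hC⟩ := h0.exists_link_neighbors (Set.mem_univ u) (Set.mem_univ w) huw hadj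
          exact ⟨C, fun htC => hC.sub htC ht, hC⟩
        · push Not at ht
          obtain ⟨C, hCt, hC⟩ := (h t).exists_link_neighbors (u := u) (w := w) ht.1.symm ht.2.symm
            huw hadj
          exact ⟨C, fun htC => hCt htC rfl, hC⟩
    have path : ∀ P, IsLink G {u, w}ᶜ {x | G.Adj u x} {x | G.Adj w x} P →
        ∃ p : G.Walk u w, p.IsPath ∧ ∀ x ∈ p.support, x = u ∨ x = w ∨ x ∈ P := by
      intro P hP
      obtain ⟨a, ha, hau⟩ := hP.left
      obtain ⟨b, hb, hbw⟩ := hP.right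
      have hT := ((connSet_singleton u).union hP.conn ⟨u, rfl, a, ha, hau⟩).union
        (connSet_singleton w) ⟨b, Or.inr hb, w, rfl, SimpleGraph.Adj.symm hbw⟩
      obtain ⟨p, hp, hs⟩ := hT.exists_isPath (u := u) (w := w) (Or.inl (Or.inl rfl)) (Or.inr rfl)
      refine ⟨p, hp, fun x hx => ?_⟩
      rcases hs x hx with (h | h) | h
      · exact Or.inl h
      · exact Or.inr (Or.inr h)
      · exact Or.inr (Or.inl h)
    obtain ⟨p, hp, hps⟩ := path P hP
    obtain ⟨q, hq, hqs⟩ := path Q hQ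
    have hd' : ∀ x, x ∈ p.support → x ∈ q.support → x = u ∨ x = w := by
      intro x hx hx'
      have h1 := hps x hx
      have h2 := hqs x hx'
      have h3 : x ∈ P → x ∉ Q := fun h => Set.disjoint_left.1 hd h
      tauto
    refine exists_two_paths p q hp hq ?_ hd'
    rintro rfl
    obtain ⟨x, hx, hxu, hxw⟩ := exists_mem_support_of_not_adj p huw hadj
    exact (hd' x hx hx).elim hxu hxw

end Biconnected

section Pieces

variable {V : Type} {G : SimpleGraph V} {v : V} {C X A B D : Set V}

/-- A model of `K₄` with branch sets `X`, `A`, `B`, `D`. -/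
structure K4Model (G : SimpleGraph V) (X A B D : Set V) : Prop where
  base : TriangleModel G A B D
  conn : ConnSet G X
  disj₁ : Disjoint X A
  disj₂ : Disjoint X B
  disj₃ : Disjoint X D
  touch₁ : Touch G X A
  touch₂ : Touch G X B
  touch₃ : Touch G X D

theorem K4Model.rotate (h : K4Model G X A B D) : K4Model G X B D A :=
  ⟨h.base.rotate, h.conn, h.disj₂, h.disj₃, h.disj₁, h.touch₂, h.touch₃, h.touch₁⟩

theorem K4Model.swap (h : K4Model G X A B D) : K4Model G X A D B :=
  ⟨h.base.swap, h.conn, h.disj₁, h.disj₃, h.disj₂, h.touch₁, h.touch₃, h.touch₂⟩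

theorem K4Model.exchange (h : K4Model G X A B D) : K4Model G A X B D :=
  ⟨⟨h.conn, h.base.conn₂, h.base.conn₃, h.disj₂, h.disj₃, h.base.disj₂₃, h.touch₂, h.touch₃,
    h.base.touch₂₃⟩, h.base.conn₁, h.disj₁.symm, h.base.disj₁₂, h.base.disj₁₃, h.touch₁.symm,
    h.base.touch₁₂, h.base.touch₁₃⟩

theorem K4Model.hasDiamond {T : Set V} (h : K4Model G X A B D) (hX : X ⊆ T) (hA : A ⊆ T)
    (hB : B ⊆ T) (hD : D ⊆ T) : HasDiamond G T := by
  obtain ⟨⟨cA, cB, cD, dAB, dAD, dBD, tAB, tAD, tBD⟩, cX, dXA, dXB, dXD, tXA, tXB, tXD⟩ := h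
  refine ⟨X, A, B, D, ?_, ?_, ?_, tXA, tXB, tXD, tAB, tAD⟩
  · simp [*]
  · simp [*]
  · simp [*]

theorem exists_k4Model (h : IsMinorOf (completeGraph (Fin 4)) G) :
    ∃ X A B D, K4Model G X A B D := by
  obtain ⟨f, hc, hd, ht⟩ := h
  have hc' := fun i => connected_induce_iff_connSet.1 (hc i)
  have ht' : ∀ i j, i ≠ j → Touch G (f i) (f j) := fun i j hij => ht hij
  exact ⟨f 0, f 1, f 2, f 3, ⟨hc' 1, hc' 2, hc' 3, hd (by decide), hd (by decide), hd (by decide),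
    ht' _ _ (by decide), ht' _ _ (by decide), ht' _ _ (by decide)⟩, hc' 0, hd (by decide),
    hd (by decide), hd (by decide), ht' _ _ (by decide), ht' _ _ (by decide), ht' _ _ (by decide)⟩

theorem K4Model.two_lt_card [Finite V] (h : K4Model G X A B D) : 2 < Nat.card V := by
  obtain ⟨x, hx⟩ := h.conn.1
  obtain ⟨a, ha⟩ := h.base.conn₁.1
  obtain ⟨b, hb⟩ := h.base.conn₂.1
  have h1 : x ≠ a := h.disj₁.ne_of_mem hx ha
  have h2 : x ≠ b := h.disj₂.ne_of_mem hx hb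
  have h3 : a ≠ b := h.base.disj₁₂.ne_of_mem ha hb
  rw [← Set.ncard_univ]
  exact (Set.two_lt_ncard).2 ⟨x, by simp, a, by simp, b, by simp, h1, h2, h3⟩

/-- `C` is separated from the rest of `G` by `v` and contains three branch sets of a model
of `K₄`. -/
structure IsPiece (G : SimpleGraph V) (v : V) (C : Set V) : Prop where
  notMem : v ∉ C
  closed : ∀ a ∈ C, ∀ b, b ∉ C → b ≠ v → ¬ G.Adj a b
  ne_univ : insert v C ≠ Set.univ
  exists_model : ∃ X A B D, K4Model G X A B D ∧ A ⊆ C ∧ B ⊆ C ∧ D ⊆ C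

/-- If a set has no edges leaving it except to `v`, connected sets avoiding `v` do not leave it. -/
theorem IsPiece.subset (h : IsPiece G v C) {T : Set V} (hT : ConnSet G T) (hv : v ∉ T)
    (hTC : ¬ Disjoint T C) : T ⊆ C := by
  obtain ⟨x, hx, hxC⟩ := Set.not_disjoint_iff.1 hTC
  exact hT.2 C ⟨x, hx, hxC⟩ fun a _ haC b hb hab => by_contra fun hbC =>
    h.closed a haC b hbC (fun e => hv (e ▸ hb)) hab

theorem K4Model.exists_notMem (h : K4Model G X A B D) (v : V) :
    ∃ X A B D, K4Model G X A B D ∧ v ∉ A ∧ v ∉ B ∧ v ∉ D := by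
  have nm : ∀ {P Q : Set V}, Disjoint P Q → v ∈ P → v ∉ Q := fun hd => fun h1 h2 =>
    Set.disjoint_left.1 hd h1 h2
  by_cases hA : v ∈ A
  · exact ⟨A, X, B, D, h.exchange, nm h.disj₁.symm hA, nm h.base.disj₁₂ hA, nm h.base.disj₁₃ hA⟩
  by_cases hB : v ∈ B
  · exact ⟨B, X, D, A, h.rotate.exchange, nm h.disj₂.symm hB, nm h.base.disj₂₃ hB, hA⟩
  by_cases hD : v ∈ D
  · exact ⟨D, X, A, B, h.rotate.rotate.exchange, nm h.disj₃.symm hD, hA, hB⟩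
  exact ⟨X, A, B, D, h, hA, hB, hD⟩

theorem K4Model.exists_isPiece (h : K4Model G X A B D) (hv : ¬ ConnSet G {v}ᶜ) :
    ∃ C, IsPiece G v C := by
  obtain ⟨X, A, B, D, h, hA, hB, hD⟩ := h.exists_notMem v
  obtain ⟨a, ha⟩ := h.base.conn₁.1
  have hav : a ∈ ({v}ᶜ : Set V) := fun e => hA (Set.mem_singleton_iff.1 e ▸ ha)
  obtain ⟨K, hK, haK, hKc, hcl⟩ := exists_component (G := G) hav
  have hsub : ∀ T, ConnSet G T → v ∉ T → (∃ x ∈ T, x ∈ K) → T ⊆ K := fun T hT hvT hx =>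
    hT.2 K hx fun p _ hpK q hq hpq => hcl p hpK q (fun e => hvT (Set.mem_singleton_iff.1 e ▸ hq)) hpq
  have hAK := hsub A h.base.conn₁ hA ⟨a, ha, haK⟩
  have htouch : ∀ T, ConnSet G T → v ∉ T → Touch G A T → T ⊆ K := by
    rintro T hT hvT ⟨p, hp, q, hq, hpq⟩
    exact hsub T hT hvT ⟨q, hq, hcl p (hAK hp) q (fun e => hvT (Set.mem_singleton_iff.1 e ▸ hq)) hpq⟩
  refine ⟨K, fun hvK => hK hvK rfl, fun p hp b hb hbv hpb => hb (hcl p hp b hbv hpb), fun hu => ?_,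
    X, A, B, D, h, hAK, htouch B h.base.conn₂ hB h.base.touch₁₂,
    htouch D h.base.conn₃ hD h.base.touch₁₃⟩
  have : K = {v}ᶜ := hK.antisymm fun x hx => by
    have hx' : x ∈ insert v K := hu ▸ Set.mem_univ x
    exact hx'.resolve_left hx
  exact hv (this ▸ hKc)

theorem IsPiece.connSet_compl (h : IsPiece G v C) (h0 : ConnSet G Set.univ) : ConnSet G Cᶜ := by
  have h1 := h0.inter_insert (v := v) (Set.mem_univ v) (U := (insert v C)ᶜ) fun a ha b _ hb hbv hab => by
    have ha' : ¬ (a = v ∨ a ∈ C) := ha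
    have hb' : b = v ∨ b ∈ C := not_not.1 hb
    exact h.closed b (hb'.resolve_left hbv) a (fun hh => ha' (Or.inr hh)) (fun hh => ha' (Or.inl hh))
      hab.symm
  have e : Set.univ ∩ insert v (insert v C)ᶜ = Cᶜ := by
    ext x
    have := h.notMem
    by_cases hx : x = v
    · subst hx; simpa using this
    · simp [hx]
  exact e ▸ h1

theorem IsPiece.connSet_insert (h : IsPiece G v C) (h0 : ConnSet G Set.univ) :
    ConnSet G (insert v C) := by
  have h1 := h0.inter_insert (v := v) (Set.mem_univ v) (U := C) fun a ha b _ hb hbv =>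
    h.closed a ha b hb hbv
  rwa [Set.univ_inter] at h1

theorem exists_leaf [Finite V] [Nontrivial V] (hc : G.Connected) (ha : G.IsAcyclic) (v : V) :
    ∃ x, x ≠ v ∧ ∀ a b, G.Adj x a → G.Adj x b → a = b := by
  obtain ⟨x, hx⟩ := Finite.exists_max (G.dist v)
  obtain ⟨w, hw⟩ := exists_ne v
  refine ⟨x, ?_, ?_⟩
  · rintro rfl
    have h1 := hx w
    rw [dist_self] at h1
    exact hw ((hc.dist_eq_zero_iff).1 (Nat.le_zero.1 h1)).symm
  · have key : ∀ a, G.Adj x a → ∃ p : G.Walk v a, p.IsPath ∧ x ∉ p.support := by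
      intro a hxa
      obtain ⟨p, hp, hl⟩ := hc.exists_path_of_dist v a
      refine ⟨p, hp, fun hxp => ?_⟩
      classical
      have h1 := dist_le (p.takeUntil x hxp)
      have h2 := p.length_takeUntil_lt_length hxp hxa.ne
      have h3 := hx a
      omega
    intro a b hxa hxb
    obtain ⟨p, hp, hxp⟩ := key a hxa
    obtain ⟨q, hq, hxq⟩ := key b hxb
    have hp' := hp.concat hxp hxa.symm
    have hq' := hq.concat hxq hxb.symm
    have := (ha.subsingleton_path v x).elim ⟨_, hp'⟩ ⟨_, hq'⟩
    exact (Walk.concat_inj (Subtype.ext_iff.1 this)).1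

theorem IsPiece.not_isAcyclic_compl [Finite V] (h : IsPiece G v C) (h0 : ConnSet G Set.univ)
    (hG : ObsApexPseudoforest G) : ¬ (G.induce Cᶜ).IsAcyclic := by
  intro hac
  obtain ⟨y, hy⟩ : ∃ y, y ∉ insert v C := by
    by_contra! hall
    exact h.ne_univ (Set.eq_univ_of_forall hall)
  have hy' : y ≠ v ∧ y ∉ C := by simpa using hy
  have : Nontrivial (Cᶜ : Set V) := ⟨⟨y, hy'.2⟩, ⟨v, h.notMem⟩, fun e => hy'.1 (congrArg Subtype.val e)⟩
  obtain ⟨⟨x, hxC⟩, hxv, hx⟩ := exists_leaf (connected_induce_iff_connSet.2 (h.connSet_compl h0)) hac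
    ⟨v, h.notMem⟩
  have hxv' : x ≠ v := fun e => hxv (Subtype.ext e)
  have hn : ∀ a, G.Adj x a → a ∉ C := fun a hxa haC => h.closed a haC x hxC hxv' hxa.symm
  have hleaf : ∀ a b, G.Adj x a → G.Adj x b → a = b := fun a b ha hb =>
    congrArg Subtype.val (hx ⟨a, hn a ha⟩ ⟨b, hn b hb⟩ ha hb)
  obtain ⟨s, hs, hss, hpf⟩ := hG.exists_of_ne_univ (S := {x}ᶜ) fun e => by
    have : x ∈ ({x}ᶜ : Set V) := e ▸ Set.mem_univ x
    exact this rfl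
  refine not_pseudoforest_sdiff_leaf (fun a _ b _ => hleaf a b) (hG.not_pseudoforest_compl hss) ?_
  rwa [Set.sdiff_eq, Set.inter_comm, ← Set.sdiff_eq]

theorem IsPiece.exists_isPendant [Finite V] (h : IsPiece G v C) (h0 : ConnSet G Set.univ)
    (hG : ObsApexPseudoforest G) : ∃ Y₀ Y₁ Y₂, IsPendant G v (insert v C) Y₀ Y₁ Y₂ := by
  obtain ⟨Y₀, Y₁, Y₂, hY, hu, hv⟩ := (h.connSet_compl h0).exists_triangleModel_of_mem
    (h.not_isAcyclic_compl h0 hG) h.notMem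
  have hs : ∀ x, x ∈ Y₀ ∨ x ∈ Y₁ ∨ x ∈ Y₂ → x ∉ C := by
    intro x hx
    have : x ∈ Cᶜ := by rw [← hu]; simpa [or_assoc] using hx
    exact this
  refine ⟨Y₀, Y₁, Y₂, hY, hv, ?_, ?_, ?_⟩
  · rintro x ⟨hx, rfl | hxC⟩
    · rfl
    · exact absurd hxC (hs x (Or.inl hx))
  · refine Set.disjoint_left.2 ?_
    rintro x hx (rfl | hxC)
    · exact Set.disjoint_left.1 hY.disj₁₂ hv hx
    · exact hs x (Or.inr (Or.inl hx)) hxC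
  · refine Set.disjoint_left.2 ?_
    rintro x hx (rfl | hxC)
    · exact Set.disjoint_left.1 hY.disj₁₃ hv hx
    · exact hs x (Or.inr (Or.inr hx)) hxC

theorem IsPiece.exists_model_subset (h : IsPiece G v C) :
    ∃ X A B D, K4Model G X A B D ∧ X ⊆ insert v C ∧ A ⊆ C ∧ B ⊆ C ∧ D ⊆ C := by
  obtain ⟨X, A, B, D, hm, hA, hB, hD⟩ := h.exists_model
  by_cases hv : v ∈ X
  · have ht : ∀ T ⊆ C, Touch G X T → Touch G (X ∩ insert v C) T := by
      rintro T hT ⟨x, hx, t, htT, hxt⟩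
      refine ⟨x, ⟨hx, ?_⟩, t, htT, hxt⟩
      by_contra hxC
      have : x ≠ v ∧ x ∉ C := by simpa using hxC
      exact h.closed t (hT htT) x this.2 this.1 hxt.symm
    exact ⟨X ∩ insert v C, A, B, D, ⟨hm.base, hm.conn.inter_insert hv fun a ha b _ hb hbv =>
      h.closed a ha b hb hbv, hm.disj₁.mono_left Set.inter_subset_left,
      hm.disj₂.mono_left Set.inter_subset_left, hm.disj₃.mono_left Set.inter_subset_left,
      ht A hA hm.touch₁, ht B hB hm.touch₂, ht D hD hm.touch₃⟩, Set.inter_subset_right, hA, hB, hD⟩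
  · refine ⟨X, A, B, D, hm, (h.subset hm.conn hv ?_).trans (Set.subset_insert _ _), hA, hB, hD⟩
    obtain ⟨x, hx, a, ha, hxa⟩ := hm.touch₁
    refine Set.not_disjoint_iff.2 ⟨x, hx, by_contra fun hxC => ?_⟩
    exact h.closed a (hA ha) x hxC (fun e => hv (e ▸ hx)) hxa.symm

theorem IsPiece.not_pseudoforest [Finite V] (h : IsPiece G v C) (hG : ObsApexPseudoforest G)
    (hE : ExcludesMinors G) : ¬ Pseudoforest (G.induce C) := by
  obtain ⟨T, hTv, hT, -, hTn⟩ := exists_connSet_not_pseudoforest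
    (hG.not_pseudoforest_compl (Set.subsingleton_singleton (a := v)))
  have hvT : v ∉ T := fun hh => hTv hh rfl
  by_cases hd : Disjoint T C
  · exfalso
    obtain ⟨X, A, B, D, hm, hX, hA, hB, hD⟩ := h.exists_model_subset
    have hC := Set.subset_insert v C
    refine hE.not_disjoint (Or.inl (hm.hasDiamond hX (hA.trans hC) (hB.trans hC) (hD.trans hC)))
      (hT.hasDiamond_or_hasButterfly hTn) ?_
    exact Set.disjoint_insert_left.2 ⟨hvT, hd.symm⟩
  · exact fun hpf => hTn (hpf.induce_mono (h.subset hT hvT hd))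

/-- A model of `K₄` partitioning `insert v C`, whose first branch set contains `v`. -/
structure IsFrame (G : SimpleGraph V) (v : V) (C X A B D : Set V) : Prop where
  model : K4Model G X A B D
  mem : v ∈ X
  union : ∀ x, x ∈ insert v C ↔ x ∈ X ∨ x ∈ A ∨ x ∈ B ∨ x ∈ D

theorem IsPiece.exists_isFrame [Finite V] (h : IsPiece G v C) (h0 : ConnSet G Set.univ) :
    ∃ X A B D, IsFrame G v C X A B D := by
  obtain ⟨X, A, B, D, hm, hX, hA, hB, hD⟩ := h.exists_model_subset
  have hC := Set.subset_insert v C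
  have hd := hm.base.disj₁₂
  have hd2 := hm.base.disj₁₃
  have hd3 := hm.base.disj₂₃
  have hd4 := hm.disj₁
  have hd5 := hm.disj₂
  have hd6 := hm.disj₃
  obtain ⟨g, h1, h2, h3, h4⟩ := (h.connSet_insert h0).exists_spanning ![X, A, B, D]
    (by
      intro i
      fin_cases i
      exacts [hm.conn, hm.base.conn₁, hm.base.conn₂, hm.base.conn₃])
    (by
      intro i j hij
      fin_cases i <;> fin_cases j <;> first | exact absurd rfl hij | skip
      exacts [hd4, hd5, hd6, hd4.symm, hd, hd2, hd5.symm, hd.symm, hd3, hd6.symm, hd2.symm,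
        hd3.symm])
    (by
      intro i
      fin_cases i
      exacts [hX, hA.trans hC, hB.trans hC, hD.trans hC])
  have hX' : X ⊆ g 0 := h1 0
  have hA' : A ⊆ g 1 := h1 1
  have hB' : B ⊆ g 2 := h1 2
  have hD' : D ⊆ g 3 := h1 3
  have hg : K4Model G (g 0) (g 1) (g 2) (g 3) :=
    ⟨⟨h2 _, h2 _, h2 _, h3 _ _ (by decide), h3 _ _ (by decide), h3 _ _ (by decide),
      hm.base.touch₁₂.mono hA' hB', hm.base.touch₁₃.mono hA' hD', hm.base.touch₂₃.mono hB' hD'⟩,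
      h2 _, h3 _ _ (by decide), h3 _ _ (by decide), h3 _ _ (by decide), hm.touch₁.mono hX' hA',
      hm.touch₂.mono hX' hB', hm.touch₃.mono hX' hD'⟩
  have hu : ∀ x, x ∈ insert v C ↔ x ∈ g 0 ∨ x ∈ g 1 ∨ x ∈ g 2 ∨ x ∈ g 3 := by
    intro x
    rw [← h4]
    simp [Set.mem_iUnion, Fin.exists_fin_succ]
  rcases (hu v).1 (Set.mem_insert v C) with hv | hv | hv | hv
  · exact ⟨_, _, _, _, hg, hv, hu⟩
  · exact ⟨_, _, _, _, hg.exchange, hv, fun x => (hu x).trans (by tauto)⟩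
  · exact ⟨_, _, _, _, hg.rotate.exchange, hv, fun x => (hu x).trans (by tauto)⟩
  · exact ⟨_, _, _, _, hg.rotate.rotate.exchange, hv, fun x => (hu x).trans (by tauto)⟩

theorem IsFrame.rotate (h : IsFrame G v C X A B D) : IsFrame G v C X B D A :=
  ⟨h.model.rotate, h.mem, fun x => (h.union x).trans (by tauto)⟩

end Pieces

section Singleton

variable {V : Type} {G : SimpleGraph V} {v : V} {C D A B P Q R Y₀ Y₁ Y₂ : Set V}

theorem IsPendant.false_of_two_triangles (hE : ExcludesMinors G)
    (hp : IsPendant G v D Y₀ Y₁ Y₂) (h : TriangleModel G {v} B C) (k : TriangleModel G P Q R)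
    (hvk : v ∉ P ∪ Q ∪ R) (hB : Disjoint (P ∪ Q ∪ R) B) (hC : Disjoint (P ∪ Q ∪ R) C)
    (hvD : v ∈ D) (hBD : B ⊆ D) (hCD : C ⊆ D) (hPQR : P ∪ Q ∪ R ⊆ D)
    (tv : Touch G {v} (P ∪ Q ∪ R)) (tB : Touch G (P ∪ Q ∪ R) B)
    (tC : Touch G (P ∪ Q ∪ R) C) : False := by
  have touch : ∀ {P Q R T : Set V}, Touch G (P ∪ Q ∪ R) T →
      Touch G P T ∨ Touch G Q T ∨ Touch G R T := fun ht => by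
    rcases ht.union_left with ht | ht
    · exact ht.union_left.imp_right Or.inl
    · exact Or.inr (Or.inr ht)
  have aux : ∀ {P Q R : Set V}, TriangleModel G P Q R → v ∉ P ∪ Q ∪ R →
      Disjoint (P ∪ Q ∪ R) B → Disjoint (P ∪ Q ∪ R) C → P ∪ Q ∪ R ⊆ D →
      Touch G {v} (P ∪ Q ∪ R) → Touch G P B → Touch G Q C → False := by
    intro P Q R k hvk hB hC hPQR tv tB tC
    obtain ⟨cv, cB, cC, dvB, dvC, dBC, tvB, tvC, tBC⟩ := h
    obtain ⟨cP, cQ, cR, dPQ, dPR, dQR, tPQ, tPR, tQR⟩ := k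
    simp only [Set.mem_union, not_or, Set.disjoint_union_left, Set.union_subset_iff,
      Set.disjoint_singleton_left] at *
    have dQC := hC.1.2
    rcases touch tv.symm with t | t | t
    · refine hE.o8 (hp.isMinorOf_O8 (M := {v}) (A := B) (E := P) (F := C ∪ Q) (B := R) rfl ?_ ?_ ?_
        tvB t.symm (tvC.mono subset_rfl Set.subset_union_left) tB.symm
        (tBC.mono subset_rfl Set.subset_union_left)
        (tPQ.mono subset_rfl Set.subset_union_right) tPR.symm
        (tQR.symm.mono subset_rfl Set.subset_union_right))
      · simp [*, cC.union cQ tC.symm]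
      · simp [*]
      · simp [*, hB.1.1.symm, hB.1.2.symm, hB.2.symm, hC.1.1, hC.2.symm]
    · refine hE.o8 (hp.isMinorOf_O8 (M := {v}) (A := C) (E := Q) (F := B ∪ P) (B := R) rfl ?_ ?_ ?_
        tvC t.symm (tvB.mono subset_rfl Set.subset_union_left) tC.symm
        (tBC.symm.mono subset_rfl Set.subset_union_left)
        (tPQ.symm.mono subset_rfl Set.subset_union_right) tQR.symm
        (tPR.symm.mono subset_rfl Set.subset_union_right))
      · simp [*, cB.union cP tB.symm]
      · simp [*]
      · simp [*, hC.1.1.symm, hC.1.2.symm, hC.2.symm, hB.1.2, hB.2.symm, dBC.symm, dPQ.symm]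
    · refine hE.o31 (isMinorOf_mkGraph [{v}, B, C, R, P, Q] _ ?_ ?_ ?_)
      · simp [*]
      · simp [*, hB.1.1.symm, hB.1.2.symm, hB.2.symm, hC.1.1.symm, hC.1.2.symm, hC.2.symm,
          dPR.symm, dQR.symm]
      · simp only [List.forall_mem_cons, List.not_mem_nil, false_imp_iff, implies_true, and_true]
        exact ⟨tvB, tvC, tBC, tPR.symm, tQR.symm, tPQ, t.symm, tB.symm, tC.symm⟩
  have aux' : ∀ {P Q R : Set V}, TriangleModel G P Q R → v ∉ P ∪ Q ∪ R →
      Disjoint (P ∪ Q ∪ R) B → Disjoint (P ∪ Q ∪ R) C → P ∪ Q ∪ R ⊆ D →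
      Touch G {v} (P ∪ Q ∪ R) → Touch G P B → Touch G (P ∪ Q ∪ R) C → False := by
    intro P Q R k hvk hB hC hPQR tv tB tC
    rcases touch tC with t | t | t
    · obtain ⟨cv, cB, cC, dvB, dvC, dBC, tvB, tvC, tBC⟩ := h
      obtain ⟨cP, cQ, cR, dPQ, dPR, dQR, tPQ, tPR, tQR⟩ := k
      simp only [Set.mem_union, not_or, Set.disjoint_union_left, Set.union_subset_iff,
        Set.disjoint_singleton_left] at *
      refine hE.o4 (hp.isMinorOf_O4 (M := {v}) (S := B) (T := C) (F := P) (A := Q) (B := R) rfl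
        ?_ ?_ ?_ tvB tvC tBC tB.symm t.symm tPQ tPR tQR)
      · simp [*]
      · simp [*]
      · simp [*, hB.1.1.symm, hB.1.2.symm, hB.2.symm, hC.1.1.symm, hC.1.2.symm, hC.2.symm]
    · exact aux k hvk hB hC hPQR tv tB t
    · have e : P ∪ Q ∪ R = P ∪ R ∪ Q := by ext; simp; tauto
      rw [e] at hvk hB hC hPQR tv
      exact aux k.swap hvk hB hC hPQR tv tB t
  rcases touch tB with t | t | t
  · exact aux' k hvk hB hC hPQR tv t tC
  · have e : P ∪ Q ∪ R = Q ∪ R ∪ P := by ext; simp; tauto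
    rw [e] at hvk hB hC hPQR tv tC
    exact aux' k.rotate hvk hB hC hPQR tv t tC
  · have e : P ∪ Q ∪ R = R ∪ P ∪ Q := by ext; simp; tauto
    rw [e] at hvk hB hC hPQR tv tC
    exact aux' k.rotate.rotate hvk hB hC hPQR tv t tC

theorem IsPendant.isAcyclic [Finite V] (hE : ExcludesMinors G) (hp : IsPendant G v D Y₀ Y₁ Y₂)
    (h : K4Model G {v} A B C) (hv : v ∈ D) (hA : A ⊆ D) (hB : B ⊆ D) (hC : C ⊆ D) :
    (G.induce A).IsAcyclic := by
  by_contra hac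
  obtain ⟨P, Q, R, k, rfl⟩ := h.base.conn₁.exists_triangleModel hac
  exact hp.false_of_two_triangles hE ⟨h.conn, h.base.conn₂, h.base.conn₃, h.disj₂, h.disj₃,
    h.base.disj₂₃, h.touch₂, h.touch₃, h.base.touch₂₃⟩ k (Set.disjoint_singleton_left.1 h.disj₁)
    h.base.disj₁₂ h.base.disj₁₃ hv hB hC hA h.touch₁ h.base.touch₁₂ h.base.touch₁₃

theorem IsPendant.not_doubleTouch [Finite V] (hE : ExcludesMinors G)
    (hp : IsPendant G v D Y₀ Y₁ Y₂) (h : K4Model G {v} A B C) (hv : v ∈ D) (hA : A ⊆ D)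
    (hB : B ⊆ D) (hC : C ⊆ D) : ¬ DoubleTouch G A B := by
  intro hd
  obtain ⟨P, Q, cP, cQ, dPQ, hPQ, tPQ, tPB, tQB⟩ := hd.exists_split h.base.conn₁
  have aux : ∀ {P Q : Set V}, ConnSet G P → ConnSet G Q → Disjoint P Q → P ∪ Q = A →
      Touch G P Q → Touch G P B → Touch G Q B → Touch G P C → False := by
    rintro P Q cP cQ dPQ rfl tPQ tPB tQB tPC
    obtain ⟨⟨-, cB, cC, dPQB, dPQC, dBC, -, -, tBC⟩, cv, dvPQ, dvB, dvC, tv, tvB, tvC⟩ := h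
    simp only [Set.mem_union, not_or, Set.disjoint_union_left, Set.union_subset_iff,
      Set.disjoint_singleton_left] at *
    rcases tv.symm.union_left with t | t
    · refine hE.o8 (hp.isMinorOf_O8 (M := {v}) (A := C) (E := P) (F := B) (B := Q) rfl ?_ ?_ ?_
        tvC t.symm tvB tPC.symm tBC.symm tPB tPQ.symm tQB)
      · simp [*]
      · simp [*]
      · simp [*, dPQB.2.symm, dPQC.1.symm, dPQC.2.symm, dBC.symm]
    · refine hE.o7 (hp.isMinorOf_O7 (M := {v}) (E := C) (F := Q) (S := P) (T := B) rfl ?_ ?_ ?_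
        tvC t.symm tPB tPC.symm tBC.symm tPQ.symm tQB)
      · simp [*]
      · simp [*]
      · simp [*, dPQC.1.symm, dPQC.2.symm, dBC.symm, dPQ.symm]
  have tAC := h.base.touch₁₃
  rw [← hPQ] at tAC
  rcases tAC.union_left with t | t
  · exact aux cP cQ dPQ hPQ tPQ tPB tQB t
  · exact aux cQ cP dPQ.symm (by rw [Set.union_comm, hPQ]) tPQ.symm tQB tPB t

theorem IsPendant.pseudoforest [Finite V] (hE : ExcludesMinors G)
    (hp : IsPendant G v D Y₀ Y₁ Y₂) (h : K4Model G {v} A B C) (hv : v ∈ D) (hA : A ⊆ D)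
    (hB : B ⊆ D) (hC : C ⊆ D) : Pseudoforest (G.induce (A ∪ B ∪ C)) := by
  by_contra hn
  rcases exists_not_isAcyclic_or_doubleTouch h.base.disj₁₂ h.base.disj₁₃ h.base.disj₂₃ hn with
    (k | k | k) | k | k | k | k | k | k
  · exact k (hp.isAcyclic hE h hv hA hB hC)
  · exact k (hp.isAcyclic hE h.rotate hv hB hC hA)
  · exact k (hp.isAcyclic hE h.rotate.rotate hv hC hA hB)
  · exact hp.not_doubleTouch hE h hv hA hB hC k
  · exact hp.not_doubleTouch hE h.swap hv hA hC hB k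
  · exact hp.not_doubleTouch hE h.rotate hv hB hC hA k
  · exact hp.not_doubleTouch hE h.rotate.swap hv hB hA hC k
  · exact hp.not_doubleTouch hE h.rotate.rotate hv hC hA hB k
  · exact hp.not_doubleTouch hE h.rotate.rotate.swap hv hC hB hA k

end Singleton

section MinimalPiece

variable {V : Type} {G : SimpleGraph V} {v : V} {C K X A B D Y₀ Y₁ Y₂ : Set V}

/-- `K` is a connected component of the first branch set without `v`. -/
structure IsBranch (G : SimpleGraph V) (v : V) (X K : Set V) : Prop where
  sub : K ⊆ X
  notMem : v ∉ K
  conn : ConnSet G K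
  closed : ∀ a ∈ K, ∀ b ∈ X, b ≠ v → G.Adj a b → b ∈ K

theorem IsBranch.connSet_sdiff (h : IsBranch G v X K) (hX : ConnSet G X) (hv : v ∈ X) :
    ConnSet G (X \ K) := by
  have h1 := hX.inter_insert hv (U := X \ insert v K) fun a ha b hb hbn hbv hab => by
    have hbK : b ∈ K := by
      by_contra hbK
      exact hbn ⟨hb, by simp [hbv, hbK]⟩
    have ha' : a ≠ v ∧ a ∉ K := by simpa using ha.2
    exact ha'.2 (h.closed b hbK a ha.1 ha'.1 hab.symm)
  have e : X ∩ insert v (X \ insert v K) = X \ K := by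
    ext x
    have := h.notMem
    by_cases hx : x = v
    · subst hx; simp [this]
    · simp [hx]
  exact e ▸ h1

theorem IsBranch.touch (h : IsBranch G v X K) (hX : ConnSet G X) (hv : v ∈ X) :
    Touch G (X \ K) K := by
  obtain ⟨x, hx⟩ := h.conn.1
  obtain ⟨a, haX, haK, b, hbX, hbK, hab⟩ := hX.cross (U := K) ⟨x, h.sub hx, hx⟩ ⟨v, hv, h.notMem⟩
  exact ⟨b, ⟨hbX, hbK⟩, a, haK, hab.symm⟩

theorem IsFrame.subset (h : IsFrame G v C X A B D) : X ⊆ insert v C :=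
  fun x hx => (h.union x).2 (Or.inl hx)

theorem IsFrame.subset₁ (h : IsFrame G v C X A B D) : A ⊆ C := fun x hx =>
  ((h.union x).2 (Or.inr (Or.inl hx))).resolve_left fun e =>
    Set.disjoint_left.1 h.model.disj₁ h.mem (e ▸ hx)

theorem IsFrame.subset₂ (h : IsFrame G v C X A B D) : B ⊆ C := h.rotate.subset₁

theorem IsFrame.subset₃ (h : IsFrame G v C X A B D) : D ⊆ C := h.rotate.rotate.subset₁

theorem IsFrame.touch_or (h : IsFrame G v C X A B D) (K : Set V) :
    Touch G (X \ K) A ∨ Touch G K A := by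
  obtain ⟨x, hx, a, ha, hxa⟩ := h.model.touch₁
  by_cases hxK : x ∈ K
  · exact Or.inr ⟨x, hxK, a, ha, hxa⟩
  · exact Or.inl ⟨x, ⟨hx, hxK⟩, a, ha, hxa⟩

theorem IsFrame.move (h : IsFrame G v C X A B D) (hK : IsBranch G v X K) (tKA : Touch G K A)
    (tB : Touch G (X \ K) B) (tD : Touch G (X \ K) D) : IsFrame G v C (X \ K) (A ∪ K) B D := by
  have hm := h.model
  have hb := h.model.base
  have hs : X \ K ⊆ X := Set.sdiff_subset
  refine ⟨⟨⟨hb.conn₁.union hK.conn tKA.symm, hb.conn₂, hb.conn₃,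
    Set.disjoint_union_left.2 ⟨hb.disj₁₂, hm.disj₂.mono_left hK.sub⟩,
    Set.disjoint_union_left.2 ⟨hb.disj₁₃, hm.disj₃.mono_left hK.sub⟩, hb.disj₂₃,
    hb.touch₁₂.mono Set.subset_union_left subset_rfl,
    hb.touch₁₃.mono Set.subset_union_left subset_rfl, hb.touch₂₃⟩,
    hK.connSet_sdiff hm.conn h.mem,
    Set.disjoint_union_right.2 ⟨hm.disj₁.mono_left hs, Set.disjoint_sdiff_left⟩,
    hm.disj₂.mono_left hs, hm.disj₃.mono_left hs,
    (hK.touch hm.conn h.mem).mono subset_rfl Set.subset_union_right, tB, tD⟩,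
    ⟨h.mem, hK.notMem⟩, fun x => (h.union x).trans ?_⟩
  have : x ∈ K → x ∈ X := fun hx => hK.sub hx
  simp only [Set.mem_sdiff, Set.mem_union]
  tauto

theorem IsFrame.isPiece_sdiff (h : IsFrame G v C X A B D) (hC : IsPiece G v C)
    (hK : IsBranch G v X K) (tA : ¬ Touch G K A) (tB : ¬ Touch G K B) (tD : ¬ Touch G K D) :
    IsPiece G v (C \ K) := by
  have hm := h.model
  refine ⟨fun hv => hC.notMem hv.1, ?_, fun hu => hC.ne_univ (Set.univ_subset_iff.1 ?_),
    X, A, B, D, hm,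
    Set.subset_sdiff.2 ⟨h.subset₁, hm.disj₁.symm.mono_right hK.sub⟩,
    Set.subset_sdiff.2 ⟨h.subset₂, hm.disj₂.symm.mono_right hK.sub⟩,
    Set.subset_sdiff.2 ⟨h.subset₃, hm.disj₃.symm.mono_right hK.sub⟩⟩
  · rintro a ⟨haC, haK⟩ b hb hbv hab
    by_cases hbK : b ∈ K
    · have hav : a ≠ v := fun e => hC.notMem (e ▸ haC)
      rcases (h.union a).1 (Or.inr haC) with ha | ha | ha | ha
      · exact haK (hK.closed b hbK a ha hav hab.symm)
      · exact tA ⟨b, hbK, a, ha, hab.symm⟩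
      · exact tB ⟨b, hbK, a, ha, hab.symm⟩
      · exact tD ⟨b, hbK, a, ha, hab.symm⟩
    · exact hC.closed a haC b (fun hbC => hb ⟨hbC, hbK⟩) hbv hab
  · exact hu ▸ Set.insert_subset_insert Set.sdiff_subset

theorem IsFrame.isMinorOf_O7_of_touch (h : IsFrame G v C X A B D)
    (hp : IsPendant G v (insert v C) Y₀ Y₁ Y₂) (hK : IsBranch G v X K)
    (tA : Touch G (X \ K) A) (tB : Touch G K B) (tD : Touch G K D) : IsMinorOf O7 G := by
  have cM := hK.connSet_sdiff h.model.conn h.mem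
  have tMK := hK.touch h.model.conn h.mem
  have hC := Set.subset_insert v C
  have hA := h.subset₁.trans hC
  have hB := h.subset₂.trans hC
  have hD := h.subset₃.trans hC
  have hX := h.subset
  have hKX := hK.sub.trans hX
  have hMX : X \ K ⊆ insert v C := Set.sdiff_subset.trans hX
  obtain ⟨⟨cA, cB, cD, dAB, dAD, dBD, tAB, tAD, tBD⟩, cX, dXA, dXB, dXD, -, -, -⟩ := h.model
  have hs : X \ K ⊆ X := Set.sdiff_subset
  refine hp.isMinorOf_O7 (M := X \ K) (E := K) (F := A) (S := B) (T := D) ⟨h.mem, hK.notMem⟩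
    ?_ ?_ ?_ tMK tA tBD tB tD tAB tAD
  · simp [*, hK.conn]
  · simp only [List.forall_mem_cons, List.not_mem_nil, false_imp_iff, implies_true, and_true]
    exact ⟨hMX, hKX, hA, hB, hD⟩
  · simp [*, Set.disjoint_sdiff_left, dXA.mono_left hs, dXB.mono_left hs, dXD.mono_left hs,
      dXA.mono_left hK.sub, dXB.mono_left hK.sub, dXD.mono_left hK.sub]

theorem IsFrame.isMinorOf_O7_of_split (h : IsFrame G v C X A B D)
    (hp : IsPendant G v (insert v C) Y₀ Y₁ Y₂) (hK : IsBranch G v X K) {P Q : Set V}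
    (cP : ConnSet G P) (cQ : ConnSet G Q) (dPQ : Disjoint P Q) (hPQ : P ∪ Q ⊆ K)
    (tPM : Touch G P (X \ K)) (tQM : Touch G Q (X \ K))
    (tPA : Touch G P A) (tQB : Touch G Q B) (tQD : Touch G Q D) : IsMinorOf O7 G := by
  have cM := hK.connSet_sdiff h.model.conn h.mem
  have hC := Set.subset_insert v C
  have hA := h.subset₁.trans hC
  have hB := h.subset₂.trans hC
  have hD := h.subset₃.trans hC
  have hX := h.subset
  have hPK : P ⊆ K := Set.subset_union_left.trans hPQ
  have hQK : Q ⊆ K := Set.subset_union_right.trans hPQ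
  have hPX := (hPK.trans hK.sub).trans hX
  have hQX := (hQK.trans hK.sub).trans hX
  have hMX : X \ K ⊆ insert v C := Set.sdiff_subset.trans hX
  obtain ⟨⟨cA, cB, cD, dAB, dAD, dBD, tAB, tAD, tBD⟩, cX, dXA, dXB, dXD, -, -, -⟩ := h.model
  have hs : X \ K ⊆ X := Set.sdiff_subset
  have hsP := hPK.trans hK.sub
  have hsQ := hQK.trans hK.sub
  have dK : Disjoint (X \ K) K := Set.disjoint_sdiff_left
  refine hp.isMinorOf_O7 (M := X \ K) (E := Q) (F := A ∪ P) (S := B) (T := D)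
    ⟨h.mem, hK.notMem⟩ ?_ ?_ ?_ tQM.symm (tPM.symm.mono subset_rfl Set.subset_union_right) tBD
    tQB tQD (tAB.mono Set.subset_union_left subset_rfl) (tAD.mono Set.subset_union_left subset_rfl)
  · simp [*, cA.union cP tPA.symm]
  · simp only [List.forall_mem_cons, List.not_mem_nil, false_imp_iff, implies_true, and_true]
    exact ⟨hMX, hQX, Set.union_subset hA hPX, hB, hD⟩
  · simp [*, dK.mono_right hPK, dK.mono_right hQK, dPQ.symm, dXA.mono_left hs, dXB.mono_left hs,
      dXD.mono_left hs, dXA.mono_left hsQ, dXB.mono_left hsP, dXD.mono_left hsP,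
      dXB.mono_left hsQ, dXD.mono_left hsQ]

theorem IsFrame.isPiece_reach (h : IsFrame G v C X A B D) (hC : IsPiece G v C)
    (hK : IsBranch G v X K) (tA : ¬ Touch G (X \ K) A) (tB : ¬ Touch G (X \ K) B)
    (tD : ¬ Touch G (X \ K) D) {u : V} (huK : u ∈ K)
    (hu : ∀ L, IsLink G K {x | Touch G {x} (X \ K)} {x | Touch G {x} (A ∪ B ∪ D)} L → u ∈ L) :
    IsPiece G u (A ∪ B ∪ D ∪ reach G K {x | Touch G {x} (A ∪ B ∪ D)} u) ∧
      A ∪ B ∪ D ∪ reach G K {x | Touch G {x} (A ∪ B ∪ D)} u ⊆ C \ {u} := by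
  have hm := h.model
  have huX := hK.sub huK
  have huv : u ≠ v := fun e => hK.notMem (e ▸ huK)
  have hXABD : ∀ x ∈ X, x ∉ A ∪ B ∪ D := by
    rintro x hx ((hA | hB) | hD)
    · exact Set.disjoint_left.1 hm.disj₁ hx hA
    · exact Set.disjoint_left.1 hm.disj₂ hx hB
    · exact Set.disjoint_left.1 hm.disj₃ hx hD
  have hABD : A ∪ B ∪ D ⊆ C := Set.union_subset (Set.union_subset h.subset₁ h.subset₂) h.subset₃
  have hKC : K ⊆ C := fun x hx =>
    (h.subset (hK.sub hx)).resolve_left fun e => hK.notMem (e ▸ hx)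
  have hM : ¬ Touch G (A ∪ B ∪ D) (X \ K) := fun ht => by
    rcases ht.union_left with ht | ht
    · exact ht.union_left.elim (fun ht => tA ht.symm) fun ht => tB ht.symm
    · exact tD ht.symm
  have hR : ∀ x ∈ reach G K {x | Touch G {x} (A ∪ B ∪ D)} u, x ∈ K ∧ x ≠ u := by
    rintro x ⟨L, huL, hL⟩
    obtain ⟨_, hx, rfl⟩ := hL.right
    exact ⟨hL.sub hx, fun e => huL (e ▸ hx)⟩
  have hun : u ∉ A ∪ B ∪ D ∪ reach G K {x | Touch G {x} (A ∪ B ∪ D)} u := by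
    rintro (hx | hx)
    · exact hXABD u huX hx
    · exact (hR u hx).2 rfl
  have hsub : A ∪ B ∪ D ∪ reach G K {x | Touch G {x} (A ∪ B ∪ D)} u ⊆ C :=
    Set.union_subset hABD fun x hx => hKC (hR x hx).1
  refine ⟨⟨hun, ?_, fun e => ?_, X, A, B, D, hm, ?_, ?_, ?_⟩,
    Set.subset_sdiff_singleton hsub hun⟩
  · intro a ha b hb hbu hab
    have hbC : b ∈ insert v C := by
      by_contra hbC
      have : b ≠ v ∧ b ∉ C := by simpa using hbC
      exact hC.closed a (hsub ha) b this.2 this.1 hab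
    have hb' : b ∈ X ∨ b ∈ A ∪ B ∪ D := ((h.union b).1 hbC).imp_right fun hh => by
      simpa [or_assoc] using hh
    have hbX : b ∈ X := hb'.resolve_right fun hh => hb (Or.inl hh)
    rcases ha with ha | ha
    · by_cases hbK : b ∈ K
      · exact hb (Or.inr (mem_reach_of_mem hbK ⟨b, rfl, a, ha, hab.symm⟩ hbu))
      · exact hM ⟨a, ha, b, ⟨hbX, hbK⟩, hab⟩
    · by_cases hbK : b ∈ K
      · exact hb (Or.inr (mem_reach_of_adj ha hbK hbu hab))
      · obtain ⟨L, huL, hL⟩ := ha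
        obtain ⟨_, haL, rfl⟩ := hL.right
        exact huL (hu L ⟨hL.sub, hL.conn, ⟨_, haL, _, rfl, b, ⟨hbX, hbK⟩, hab⟩, hL.left⟩)
  · have hv : v ∈ insert u (A ∪ B ∪ D ∪ reach G K {x | Touch G {x} (A ∪ B ∪ D)} u) :=
      e ▸ Set.mem_univ v
    rcases hv with hv | hv | hv
    · exact huv hv.symm
    · exact hXABD v h.mem hv
    · exact hK.notMem (hR v hv).1
  · exact fun x hx => Or.inl (Or.inl (Or.inl hx))
  · exact fun x hx => Or.inl (Or.inl (Or.inr hx))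
  · exact fun x hx => Or.inl (Or.inr hx)

theorem or_cases_of_cover {a b d a' b' d' : Prop} (hA : a ∨ a') (hB : b ∨ b') (hD : d ∨ d')
    (h : a ∨ b ∨ d) (h' : a' ∨ b' ∨ d') : (a ∧ b' ∧ d') ∨ (b ∧ d' ∧ a') ∨ (d ∧ a' ∧ b') ∨
      (a' ∧ b ∧ d) ∨ (b' ∧ d ∧ a) ∨ (d' ∧ a ∧ b) := by
  by_cases a <;> by_cases b <;> by_cases d <;> simp_all

theorem or_cases_of_exclusion {a b d a' b' d' : Prop} (hA : a ∨ a') (hB : b ∨ b') (hD : d ∨ d')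
    (h₁ : a → b' → ¬ d') (h₂ : b → d' → ¬ a') (h₃ : d → a' → ¬ b') (h : ¬ (¬ a ∧ ¬ b ∧ ¬ d)) :
    (a' ∧ b ∧ d) ∨ (b' ∧ d ∧ a) ∨ (d' ∧ a ∧ b) ∨ (¬ a' ∧ ¬ b' ∧ ¬ d') := by
  by_cases a <;> by_cases b <;> by_cases d <;> grind

theorem IsFrame.false_of_not_touch [Finite V] (h : IsFrame G v C X A B D) (hC : IsPiece G v C)
    (hmin : ∀ u C', IsPiece G u C' → C.ncard ≤ C'.ncard) (hE : ExcludesMinors G)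
    (hp : IsPendant G v (insert v C) Y₀ Y₁ Y₂) (hK : IsBranch G v X K)
    (tA : ¬ Touch G (X \ K) A) (tB : ¬ Touch G (X \ K) B) (tD : ¬ Touch G (X \ K) D) : False := by
  have kA := (h.touch_or K).resolve_left tA
  have kB := (h.rotate.touch_or K).resolve_left tB
  have kD := (h.rotate.rotate.touch_or K).resolve_left tD
  have kM := (hK.touch h.model.conn h.mem).symm
  have : Nonempty V := ⟨v⟩
  by_cases hl : ∀ u, ∃ L, u ∉ L ∧
      IsLink G K {x | Touch G {x} (X \ K)} {x | Touch G {x} (A ∪ B ∪ D)} L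
  · obtain ⟨P, Q, hd, hP, hQ⟩ := exists_disjoint_links K _ _ hl
    obtain ⟨P', Q', hPP', hQQ', cP, cQ, dPQ, hPQ, -⟩ :=
      hK.conn.exists_split hP.conn hQ.conn hd hP.sub hQ.sub
    have single : ∀ {L L' T : Set V}, L ⊆ L' → (∃ x ∈ L, x ∈ {x | Touch G {x} T}) →
        Touch G L' T := by
      rintro L L' T hLL' ⟨x, hx, ht⟩
      exact Touch.mono ht (by simpa using hLL' hx) subset_rfl
    have tPM := single hPP' hP.left
    have tQM := single hQQ' hQ.left
    have split : ∀ {L : Set V}, Touch G L (A ∪ B ∪ D) → Touch G L A ∨ Touch G L B ∨ Touch G L D := by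
      intro L ht
      rcases ht.symm.union_left with ht | ht
      · exact ht.union_left.imp Touch.symm fun ht => Or.inl ht.symm
      · exact Or.inr (Or.inr ht.symm)
    have sP := split (single hPP' hP.right)
    have sQ := split (single hQQ' hQ.right)
    rw [← hPQ] at kA kB kD
    have lA := kA.union_left
    have lB := kB.union_left
    have lD := kD.union_left
    have cases : (Touch G P' A ∧ Touch G Q' B ∧ Touch G Q' D) ∨
        (Touch G P' B ∧ Touch G Q' D ∧ Touch G Q' A) ∨
        (Touch G P' D ∧ Touch G Q' A ∧ Touch G Q' B) ∨
        (Touch G Q' A ∧ Touch G P' B ∧ Touch G P' D) ∨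
        (Touch G Q' B ∧ Touch G P' D ∧ Touch G P' A) ∨
        (Touch G Q' D ∧ Touch G P' A ∧ Touch G P' B) := or_cases_of_cover lA lB lD sP sQ
    have hr := h.rotate
    have hrr := h.rotate.rotate
    have e : Q' ∪ P' ⊆ K := by rw [Set.union_comm, hPQ]
    rcases cases with ⟨t1, t2, t3⟩ | ⟨t1, t2, t3⟩ | ⟨t1, t2, t3⟩ | ⟨t1, t2, t3⟩ | ⟨t1, t2, t3⟩ |
      ⟨t1, t2, t3⟩
    · exact hE.o7 (h.isMinorOf_O7_of_split hp hK cP cQ dPQ hPQ.subset tPM tQM t1 t2 t3)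
    · exact hE.o7 (hr.isMinorOf_O7_of_split hp hK cP cQ dPQ hPQ.subset tPM tQM t1 t2 t3)
    · exact hE.o7 (hrr.isMinorOf_O7_of_split hp hK cP cQ dPQ hPQ.subset tPM tQM t1 t2 t3)
    · exact hE.o7 (h.isMinorOf_O7_of_split hp hK cQ cP dPQ.symm e tQM tPM t1 t2 t3)
    · exact hE.o7 (hr.isMinorOf_O7_of_split hp hK cQ cP dPQ.symm e tQM tPM t1 t2 t3)
    · exact hE.o7 (hrr.isMinorOf_O7_of_split hp hK cQ cP dPQ.symm e tQM tPM t1 t2 t3)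
  · push Not at hl
    obtain ⟨u, hu⟩ := hl
    have hu' : ∀ L, IsLink G K {x | Touch G {x} (X \ K)} {x | Touch G {x} (A ∪ B ∪ D)} L →
        u ∈ L := fun L hL => by_contra fun hh => hu L hh hL
    have huK : u ∈ K := by
      refine hu' K ⟨subset_rfl, hK.conn, ?_, ?_⟩
      · obtain ⟨x, hx, y, hy, hxy⟩ := kM
        exact ⟨x, hx, x, rfl, y, hy, hxy⟩
      · obtain ⟨x, hx, y, hy, hxy⟩ := kA
        exact ⟨x, hx, x, rfl, y, Or.inl (Or.inl hy), hxy⟩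
    obtain ⟨h1, h2⟩ := h.isPiece_reach hC hK tA tB tD huK hu'
    have huC : u ∈ C :=
      (h.subset (hK.sub huK)).resolve_left fun e => hK.notMem (e ▸ huK)
    have h3 := Set.ncard_le_ncard h2
    have h4 := Set.ncard_sdiff_singleton_lt_of_mem huC
    have h5 := hmin u _ h1
    omega

theorem IsPiece.eq_singleton [Finite V] (hC : IsPiece G v C)
    (hmin : ∀ u C', IsPiece G u C' → C.ncard ≤ C'.ncard) (hE : ExcludesMinors G)
    (hp : IsPendant G v (insert v C) Y₀ Y₁ Y₂) (h : IsFrame G v C X A B D)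
    (hXmin : ∀ X' A' B' D', IsFrame G v C X' A' B' D' → X.ncard ≤ X'.ncard) : X = {v} := by
  by_contra hne
  obtain ⟨x, hx, hxv⟩ : ∃ x ∈ X, x ≠ v := by
    by_contra! hall
    exact hne (Set.Subset.antisymm hall (by simpa using h.mem))
  obtain ⟨K, hKs, hxK, cK, hcl⟩ := exists_component (G := G) (S := X \ {v}) (v := x) ⟨hx, hxv⟩
  have hK : IsBranch G v X K := ⟨fun y hy => (hKs hy).1, fun hv => (hKs hv).2 rfl, cK,
    fun a ha b hb hbv hab => hcl a ha b ⟨hb, hbv⟩ hab⟩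
  have hlt : (X \ K).ncard < X.ncard :=
    Set.ncard_lt_ncard ⟨Set.sdiff_subset, fun hh => (hh hx).2 hxK⟩
  have move : ∀ {A B D : Set V}, IsFrame G v C X A B D → Touch G K A → Touch G (X \ K) B →
      ¬ Touch G (X \ K) D := fun h' t1 t2 t3 =>
    absurd (hXmin _ _ _ _ (h'.move hK t1 t2 t3)) (not_le.2 hlt)
  have hnone : ¬ (¬ Touch G K A ∧ ¬ Touch G K B ∧ ¬ Touch G K D) := by
    rintro ⟨t1, t2, t3⟩
    have hxC : x ∈ C := (h.subset hx).resolve_left hxv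
    refine absurd (hmin v _ (h.isPiece_sdiff hC hK t1 t2 t3)) (not_le.2 ?_)
    exact Set.ncard_lt_ncard ⟨Set.sdiff_subset, fun hh => (hh hxC).2 hxK⟩
  have hr := h.rotate
  have hrr := h.rotate.rotate
  have oA := h.touch_or K
  have oB := hr.touch_or K
  have oD := hrr.touch_or K
  have mA : Touch G K A → Touch G (X \ K) B → ¬ Touch G (X \ K) D := move h
  have mB : Touch G K B → Touch G (X \ K) D → ¬ Touch G (X \ K) A := move hr
  have mD : Touch G K D → Touch G (X \ K) A → ¬ Touch G (X \ K) B := move hrr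
  have cases : (Touch G (X \ K) A ∧ Touch G K B ∧ Touch G K D) ∨
      (Touch G (X \ K) B ∧ Touch G K D ∧ Touch G K A) ∨
      (Touch G (X \ K) D ∧ Touch G K A ∧ Touch G K B) ∨
      (¬ Touch G (X \ K) A ∧ ¬ Touch G (X \ K) B ∧ ¬ Touch G (X \ K) D) :=
    or_cases_of_exclusion oA.symm oB.symm oD.symm mA mB mD hnone
  rcases cases with ⟨t1, t2, t3⟩ | ⟨t1, t2, t3⟩ | ⟨t1, t2, t3⟩ | ⟨t1, t2, t3⟩
  · exact hE.o7 (h.isMinorOf_O7_of_touch hp hK t1 t2 t3)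
  · exact hE.o7 (hr.isMinorOf_O7_of_touch hp hK t1 t2 t3)
  · exact hE.o7 (hrr.isMinorOf_O7_of_touch hp hK t1 t2 t3)
  · exact h.false_of_not_touch hC hmin hE hp hK t1 t2 t3

/-- Obstructions that exclude the listed minors have no pieces. -/
theorem ObsApexPseudoforest.not_isPiece [Finite V] (hG : ObsApexPseudoforest G)
    (hE : ExcludesMinors G) : ¬ IsPiece G v C := by
  intro hC₀
  obtain ⟨⟨v, C⟩, hC, hCmin⟩ := Set.Finite.exists_minimalFor (fun q : V × Set V => q.2.ncard)
    {q | IsPiece G q.1 q.2} (Set.toFinite _) ⟨(v, C), hC₀⟩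
  replace hC : IsPiece G v C := hC
  have hmin : ∀ u C', IsPiece G u C' → C.ncard ≤ C'.ncard := fun u C' h =>
    (le_total _ _).elim id fun hle => hCmin (j := (u, C')) h hle
  have h0 := hG.connSet_univ hE
  obtain ⟨Y₀, Y₁, Y₂, hp⟩ := hC.exists_isPendant h0 hG
  obtain ⟨X₁, A₁, B₁, D₁, h₁⟩ := hC.exists_isFrame h0
  obtain ⟨X, ⟨A, B, D, h⟩, hXmin⟩ := Set.Finite.exists_minimalFor (fun X : Set V => X.ncard)
    {X | ∃ A B D, IsFrame G v C X A B D} (Set.toFinite _) ⟨X₁, A₁, B₁, D₁, h₁⟩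
  have hXmin' : ∀ X' A' B' D', IsFrame G v C X' A' B' D' → X.ncard ≤ X'.ncard :=
    fun X' A' B' D' h' => (le_total _ _).elim id fun hle => hXmin ⟨A', B', D', h'⟩ hle
  have hX : X = {v} := hC.eq_singleton hmin hE hp h hXmin'
  subst hX
  have hs := Set.subset_insert v C
  have hpf := hp.pseudoforest hE h.model (Set.mem_insert v C) (h.subset₁.trans hs)
    (h.subset₂.trans hs) (h.subset₃.trans hs)
  refine hC.not_pseudoforest hG hE (hpf.induce_mono fun x hx => ?_)
  have hxv : x ∉ ({v} : Set V) := fun e => hC.notMem (Set.mem_singleton_iff.1 e ▸ hx)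
  simpa [or_assoc] using ((h.union x).1 (Or.inr hx)).resolve_left hxv

end MinimalPiece

/-- Every obstruction for apex-pseudoforests not isomorphic to a member of `O`
is `K₄`-minor-free or biconnected. -/
theorem obstruction_K4_or_biconnected {V : Type} [Finite V] (G : SimpleGraph V)
    (h1 : ObsApexPseudoforest G) (h2 : ¬ InO G) :
    ¬ IsMinorOf (completeGraph (Fin 4)) G ∨ KConnected 2 G := by
  by_contra! hcon
  have hE := h1.excludesMinors h2
  obtain ⟨X, A, B, D, hm⟩ := exists_k4Model hcon.1
  refine hcon.2 (kConnected_two_of_connSet hm.two_lt_card (h1.connSet_univ hE) fun v => ?_)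
  by_contra hv
  obtain ⟨C, hC⟩ := hm.exists_isPiece hv
  exact h1.not_isPiece hE hC
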